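/- For every ε > 0 there exists n₀ such that for all n ≥ n₀ the following holds: for every tree T with n + 1 vertices, the complete graph on ⌈(2 + ε)·n⌉ vertices contains at least 2n + 1 pairwise edge-disjoint copies of T. -/

import Mathlib

set_option linter.unusedSectionVars false

section Energy

variable {G : Type*} [AddCommGroup G] [Fintype G]

/-- The correlation of two real functions on a finite abelian group. -/
noncomputable def corr (φ ψ : G → ℝ) (d : G) : ℝ := ∑ y, φ y * ψ (y + d)

theorem corr_neg (φ ψ : G → ℝ) (d : G) : corr φ ψ (-d) = corr ψ φ d := by
  unfold corr
  refine Fintype.sum_equiv (Equiv.addRight (-d)) _ _ fun y => ?_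
  simp [mul_comm]

theorem sum_corr (φ ψ : G → ℝ) : ∑ d, corr φ ψ d = (∑ y, φ y) * ∑ y, ψ y := by
  unfold corr
  rw [Finset.sum_comm, Finset.sum_mul]
  refine Finset.sum_congr rfl fun y _ => ?_
  rw [← Finset.mul_sum]
  congr 1
  exact Fintype.sum_equiv (Equiv.addLeft y) _ _ fun d => rfl

theorem sum_corr_mul (φ ψ χ : G → ℝ) :
    ∑ d, χ d * corr φ ψ d = ∑ y, φ y * corr χ ψ y := by
  unfold corr
  simp only [Finset.mul_sum]
  rw [Finset.sum_comm]
  refine Finset.sum_congr rfl fun y _ => Finset.sum_congr rfl fun d _ => ?_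
  rw [add_comm y d]; ring

theorem sum_corr_sq (φ ψ : G → ℝ) :
    ∑ x, corr φ ψ x ^ 2 = ∑ d, corr φ φ d * corr ψ ψ d := by
  have h1 : ∀ x, corr φ ψ x ^ 2 = ∑ y, ∑ d, φ y * ψ (y + x) * (φ (y + d) * ψ (y + d + x)) := by
    intro x
    rw [sq]
    unfold corr
    rw [Finset.sum_mul_sum]
    refine Finset.sum_congr rfl fun y _ => ?_
    exact (Fintype.sum_equiv (Equiv.addLeft y) _ _ fun d => rfl).symm
  simp only [h1]
  rw [Finset.sum_comm]
  simp only [corr, Finset.sum_mul_sum]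
  rw [Finset.sum_comm (s := Finset.univ (α := G)) (t := Finset.univ (α := G))
    (f := fun d y => ∑ j, φ y * φ (y + d) * (ψ j * ψ (j + d)))]
  refine Finset.sum_congr rfl fun y _ => ?_
  rw [Finset.sum_comm]
  refine Finset.sum_congr rfl fun d _ => ?_
  refine Fintype.sum_equiv (Equiv.addLeft y) _ _ fun x => ?_
  simp only [Equiv.coe_addLeft]
  rw [show y + d + x = y + x + d by abel]; ring

theorem corr_add_left (φ φ' ψ : G → ℝ) (d : G) :
    corr (fun x => φ x + φ' x) ψ d = corr φ ψ d + corr φ' ψ d := by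
  simp [corr, add_mul, Finset.sum_add_distrib]

theorem corr_sub_sub (φ ψ : G → ℝ) (d : G) :
    corr (fun x => φ x - ψ x) (fun x => φ x - ψ x) d =
      corr φ φ d - corr φ ψ d - corr ψ φ d + corr ψ ψ d := by
  simp only [corr, ← Finset.sum_sub_distrib, ← Finset.sum_add_distrib]
  exact Finset.sum_congr rfl fun _ _ => by ring

theorem corr_const_left (c : ℝ) (ψ : G → ℝ) (d : G) :
    corr (fun _ => c) ψ d = c * ∑ y, ψ y := by
  unfold corr
  rw [← Finset.mul_sum]
  congr 1
  exact Fintype.sum_equiv (Equiv.addRight d) _ _ fun d => rfl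

theorem abs_corr_le_left {φ ψ : G → ℝ} (h : ∀ x, |ψ x| ≤ 1) (d : G) :
    |corr φ ψ d| ≤ ∑ y, |φ y| := by
  unfold corr
  refine (Finset.abs_sum_le_sum_abs _ _).trans (Finset.sum_le_sum fun y _ => ?_)
  rw [abs_mul]
  exact mul_le_of_le_one_right (abs_nonneg _) (h _)

theorem abs_corr_le_right {φ ψ : G → ℝ} (h : ∀ x, |φ x| ≤ 1) (d : G) :
    |corr φ ψ d| ≤ ∑ y, |ψ y| := by
  rw [← neg_neg d, corr_neg]
  exact abs_corr_le_left h _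

theorem sum_mul_le_sqrt {ι : Type*} (s : Finset ι) (f g : ι → ℝ) :
    |∑ i ∈ s, f i * g i| ≤ √(∑ i ∈ s, f i ^ 2) * √(∑ i ∈ s, g i ^ 2) := by
  rw [← Real.sqrt_mul (Finset.sum_nonneg fun _ _ => sq_nonneg _)]
  exact Real.abs_le_sqrt (Finset.sum_mul_sq_le_sq_mul_sq s f g)

theorem abs_corr_le_sqrt (φ ψ : G → ℝ) (d : G) :
    |corr φ ψ d| ≤ √(∑ y, φ y ^ 2) * √(∑ y, ψ y ^ 2) := by
  have := sum_mul_le_sqrt Finset.univ φ (fun y => ψ (y + d))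
  rwa [Fintype.sum_equiv (Equiv.addRight d) (fun y => ψ (y + d) ^ 2) (fun y => ψ y ^ 2)
    fun d => rfl] at this

theorem abs_corr_self_le (φ : G → ℝ) (d : G) : |corr φ φ d| ≤ ∑ y, φ y ^ 2 := by
  refine (abs_corr_le_sqrt φ φ d).trans_eq ?_
  exact Real.mul_self_sqrt (Finset.sum_nonneg fun _ _ => sq_nonneg _)

variable [DecidableEq G]

/-- The indicator function of a finite set. -/
def indic (S : Finset G) (x : G) : ℝ := if x ∈ S then 1 else 0

/-- The indicator function of a finite set, shifted to have mean zero. -/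
noncomputable def bal (S : Finset G) (x : G) : ℝ := indic S x - (S.card : ℝ) / Fintype.card G

/-- The balanced additive energy of a finite set. -/
noncomputable def energy (S : Finset G) : ℝ := ∑ d, corr (bal S) (bal S) d ^ 2

/-- The derivative of the balanced additive energy, up to a factor of four. -/
noncomputable def drift (S : Finset G) : G → ℝ := corr (corr (bal S) (bal S)) (bal S)

theorem sum_indic_mul (S : Finset G) (f : G → ℝ) : ∑ x, indic S x * f x = ∑ x ∈ S, f x := by
  simp [indic]

theorem sum_indic (S : Finset G) : ∑ x, indic S x = S.card := by
  simp [indic]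

theorem card_pos_real : (0 : ℝ) < Fintype.card G := by
  exact_mod_cast Fintype.card_pos_iff.mpr ⟨0⟩

theorem sum_bal (S : Finset G) : ∑ x, bal S x = 0 := by
  have := card_pos_real (G := G)
  simp only [bal, Finset.sum_sub_distrib, sum_indic, Finset.sum_const, Finset.card_univ,
    nsmul_eq_mul]
  field_simp; ring

theorem card_div_mem (S : Finset G) :
    0 ≤ (S.card : ℝ) / Fintype.card G ∧ (S.card : ℝ) / Fintype.card G ≤ 1 := by
  have := card_pos_real (G := G)
  refine ⟨by positivity, (div_le_one this).2 ?_⟩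
  exact_mod_cast S.card_le_univ

theorem abs_bal_le (S : Finset G) (x : G) : |bal S x| ≤ 1 := by
  obtain ⟨h0, h1⟩ := card_div_mem S
  unfold bal indic
  rw [abs_le]
  split_ifs <;> constructor <;> linarith

theorem sum_abs_bal_le (S : Finset G) : ∑ x, |bal S x| ≤ 2 * S.card := by
  have h := card_pos_real (G := G)
  have : ∀ x, |bal S x| ≤ indic S x + (S.card : ℝ) / Fintype.card G := by
    intro x
    obtain ⟨h0, h1⟩ := card_div_mem S
    unfold bal indic
    rw [abs_le]
    split_ifs <;> constructor <;> linarith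
  refine (Finset.sum_le_sum fun x _ => this x).trans ?_
  simp only [Finset.sum_add_distrib, sum_indic, Finset.sum_const, Finset.card_univ,
    nsmul_eq_mul]
  rw [mul_div_cancel₀ _ h.ne']; linarith

theorem sum_bal_sq_le (S : Finset G) : ∑ x, bal S x ^ 2 ≤ Fintype.card G := by
  have : ∀ x ∈ (Finset.univ : Finset G), bal S x ^ 2 ≤ 1 := fun x _ =>
    (sq_le_one_iff_abs_le_one _).2 (abs_bal_le S x)
  simpa using Finset.sum_le_sum this

theorem energy_nonneg (S : Finset G) : 0 ≤ energy S := Finset.sum_nonneg fun _ _ => sq_nonneg _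

theorem sum_drift (S : Finset G) : ∑ y, drift S y = 0 := by
  unfold drift; rw [sum_corr, sum_bal, mul_zero]

theorem sum_bal_mul_drift (S : Finset G) : ∑ y, bal S y * drift S y = energy S := by
  unfold drift energy
  rw [← sum_corr_mul]
  exact Finset.sum_congr rfl fun _ _ => by ring

theorem sum_mem_drift (S : Finset G) : ∑ y ∈ S, drift S y = energy S := by
  rw [← sum_indic_mul, ← sum_bal_mul_drift]
  simp only [bal, sub_mul, Finset.sum_sub_distrib, ← Finset.mul_sum, sum_drift, mul_zero, sub_zero]

theorem sum_bal_mul_drift' (Q S : Finset G) : ∑ y, bal Q y * drift S y = ∑ y ∈ Q, drift S y := by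
  rw [← sum_indic_mul Q (drift S)]
  simp only [bal, sub_mul, Finset.sum_sub_distrib, ← Finset.mul_sum, sum_drift, mul_zero, sub_zero]

theorem drift_sq_sum_le (S : Finset G) :
    ∑ y, drift S y ^ 2 ≤ √(Fintype.card G) * √(energy S) ^ 3 := by
  unfold drift
  rw [sum_corr_sq]
  set D := corr (bal S) (bal S)
  have hD : ∑ d, D d ^ 2 = energy S := rfl
  have h1 : ∀ d, |corr D D d| ≤ energy S := fun d => hD ▸ abs_corr_self_le D d
  have h2 : ∑ d, |D d| ≤ √(Fintype.card G) * √(energy S) := by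
    have := sum_mul_le_sqrt Finset.univ (fun _ : G => (1 : ℝ)) (fun d => |D d|)
    simp only [one_mul, sq_abs, one_pow, Finset.sum_const, Finset.card_univ, nsmul_eq_mul,
      mul_one, hD] at this
    exact (le_abs_self _).trans this
  calc ∑ d, corr D D d * D d ≤ ∑ d, energy S * |D d| := by
        refine Finset.sum_le_sum fun d _ => ?_
        calc _ ≤ |corr D D d * D d| := le_abs_self _
          _ = |corr D D d| * |D d| := abs_mul _ _
          _ ≤ _ := mul_le_mul_of_nonneg_right (h1 d) (abs_nonneg _)
    _ = energy S * ∑ d, |D d| := by rw [Finset.mul_sum]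
    _ ≤ energy S * (√(Fintype.card G) * √(energy S)) :=
        mul_le_mul_of_nonneg_left h2 (energy_nonneg S)
    _ = _ := by
        have := Real.sq_sqrt (energy_nonneg S)
        nth_rewrite 1 [← this]; ring

theorem abs_drift_le (S : Finset G) (y : G) :
    |drift S y| ≤ √(energy S) * √(Fintype.card G) := by
  refine (abs_corr_le_sqrt _ _ y).trans ?_
  exact mul_le_mul_of_nonneg_left (Real.sqrt_le_sqrt (sum_bal_sq_le S)) (Real.sqrt_nonneg _)

theorem bal_sdiff {Q S : Finset G} (h : Q ⊆ S) (x : G) : bal (S \ Q) x = bal S x - bal Q x := by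
  unfold bal indic
  rw [Finset.card_sdiff_of_subset h, Nat.cast_sub (Finset.card_le_card h)]
  by_cases h1 : x ∈ Q
  · simp [h1, h h1]; ring
  · simp [h1]; ring

theorem energy_sdiff_le {Q S : Finset G} (h : Q ⊆ S) :
    energy (S \ Q) ≤
      energy S - 4 * ∑ y ∈ Q, drift S y + 44 * Fintype.card G * (Q.card : ℝ) ^ 2 := by
  have hN := card_pos_real (G := G)
  set q : ℝ := (Q.card : ℝ)
  set N : ℝ := (Fintype.card G : ℝ)
  have hq : 0 ≤ q := Nat.cast_nonneg _
  set β := bal S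
  set ψ := bal Q
  have hD : ∀ d, |corr β β d| ≤ N := fun d => (abs_corr_self_le _ d).trans (sum_bal_sq_le S)
  have h1 : ∀ d, |corr β ψ d| ≤ 2 * q := fun d =>
    (abs_corr_le_right (abs_bal_le S) d).trans (sum_abs_bal_le Q)
  have h2 : ∀ d, |corr ψ β d| ≤ 2 * q := fun d =>
    (abs_corr_le_left (abs_bal_le S) d).trans (sum_abs_bal_le Q)
  have h3 : ∀ d, |corr ψ ψ d| ≤ 2 * q := fun d =>
    (abs_corr_le_left (abs_bal_le Q) d).trans (sum_abs_bal_le Q)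
  have h4 : ∑ d, |corr ψ ψ d| ≤ 4 * q ^ 2 := by
    calc ∑ d, |corr ψ ψ d| ≤ ∑ d, corr (fun x => |ψ x|) (fun x => |ψ x|) d := by
          refine Finset.sum_le_sum fun d _ => ?_
          unfold corr
          refine (Finset.abs_sum_le_sum_abs _ _).trans_eq ?_
          simp [abs_mul]
      _ = (∑ x, |ψ x|) * ∑ x, |ψ x| := sum_corr _ _
      _ ≤ (2 * q) * (2 * q) := by
          have := sum_abs_bal_le Q
          have h0 : 0 ≤ ∑ x, |ψ x| := Finset.sum_nonneg fun _ _ => abs_nonneg _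
          exact mul_le_mul this this h0 (by positivity)
      _ = _ := by ring
  have h6 : ∑ d, corr β β d * corr ψ β d = ∑ y ∈ Q, drift S y := by
    rw [← sum_bal_mul_drift', sum_corr_mul]; rfl
  have h5 : ∑ d, corr β β d * corr β ψ d = ∑ y ∈ Q, drift S y := by
    rw [← h6]
    refine Fintype.sum_equiv (Equiv.neg G) _ _ fun d => ?_
    rw [Equiv.neg_apply, corr_neg, corr_neg]
  have h7 : ∀ d, corr (bal (S \ Q)) (bal (S \ Q)) d ^ 2 ≤
      corr β β d ^ 2 - 2 * (corr β β d * corr β ψ d) - 2 * (corr β β d * corr ψ β d)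
        + 2 * N * |corr ψ ψ d| + 36 * q ^ 2 := by
    intro d
    have : bal (S \ Q) = fun x => β x - ψ x := funext fun x => bal_sdiff h x
    rw [this, corr_sub_sub]
    have e1 : corr β β d * corr ψ ψ d ≤ N * |corr ψ ψ d| := by
      calc _ ≤ |corr β β d * corr ψ ψ d| := le_abs_self _
        _ = |corr β β d| * |corr ψ ψ d| := abs_mul _ _
        _ ≤ _ := mul_le_mul_of_nonneg_right (hD d) (abs_nonneg _)
    have e2 : (- corr β ψ d - corr ψ β d + corr ψ ψ d) ^ 2 ≤ (6 * q) ^ 2 := by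
      rw [sq_le_sq, abs_of_nonneg (by positivity : 0 ≤ 6 * q), abs_le]
      have a1 := abs_le.1 (h1 d)
      have a2 := abs_le.1 (h2 d)
      have a3 := abs_le.1 (h3 d)
      constructor <;> linarith [a1.1, a1.2, a2.1, a2.2, a3.1, a3.2]
    nlinarith [e1, e2]
  unfold energy
  refine (Finset.sum_le_sum fun d _ => h7 d).trans ?_
  simp only [Finset.sum_add_distrib, Finset.sum_sub_distrib, ← Finset.mul_sum, h5, h6,
    Finset.sum_const, Finset.card_univ, nsmul_eq_mul]
  have : 2 * N * ∑ d, |corr ψ ψ d| ≤ 2 * N * (4 * q ^ 2) :=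
    mul_le_mul_of_nonneg_left h4 (by positivity)
  change _ ≤ ∑ d, corr β β d ^ 2 - _ + _
  linarith

theorem energy_univ : energy (Finset.univ : Finset G) = 0 := by
  have h := card_pos_real (G := G)
  have : bal (Finset.univ : Finset G) = fun _ => 0 := by
    funext x; simp [bal, indic, Finset.card_univ]
  unfold energy
  simp [this, corr]

theorem drift_univ (x : G) : drift (Finset.univ : Finset G) x = 0 := by
  have : bal (Finset.univ : Finset G) = fun _ => 0 := by
    funext x; simp [bal, indic, Finset.card_univ]
  unfold drift
  simp [this, corr]

theorem drift_neg {S : Finset G} (h : ∀ x ∈ S, -x ∈ S) (y : G) : drift S (-y) = drift S y := by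
  have hb : ∀ x, bal S (-x) = bal S x := by
    intro x
    have : -x ∈ S ↔ x ∈ S := ⟨fun hx => by simpa using h _ hx, h x⟩
    simp [bal, indic, this]
  unfold drift
  have hc : ∀ d, corr (bal S) (bal S) (-d) = corr (bal S) (bal S) d := fun d => corr_neg _ _ d
  generalize corr (bal S) (bal S) = D at hc ⊢
  unfold corr
  refine Fintype.sum_equiv (Equiv.neg G) _ _ fun x => ?_
  simp only [Equiv.neg_apply]
  rw [hc, ← hb (x + -y)]
  congr 2; abel

theorem card_filter_eq_corr (A B : Finset G) (x : G) :
    ((B.filter fun y => y - x ∈ A).card : ℝ) = corr (indic A) (indic B) x := by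
  unfold corr
  rw [Finset.card_filter, Nat.cast_sum, ← sum_indic_mul]
  refine Fintype.sum_equiv (Equiv.subRight x) _ _ fun y => ?_
  simp only [Equiv.subRight_apply, sub_add_cancel]
  rw [mul_comm]; unfold indic; split_ifs <;> simp

theorem indic_eq_bal (S : Finset G) :
    indic S = fun x => bal S x + (S.card : ℝ) / Fintype.card G := by
  funext x; simp [bal]

theorem corr_indic_left (A : Finset G) (g : G → ℝ) (x : G) :
    corr (indic A) g x = corr (bal A) g x + (A.card : ℝ) / Fintype.card G * ∑ y, g y := by
  rw [indic_eq_bal, corr_add_left, corr_const_left]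

theorem corr_indic_right (A : Finset G) (g : G → ℝ) (x : G) :
    corr g (indic A) x = corr g (bal A) x + (A.card : ℝ) / Fintype.card G * ∑ y, g y := by
  rw [← neg_neg x, corr_neg, corr_indic_left, ← corr_neg g]

theorem corr_indic_indic (A B : Finset G) (x : G) :
    corr (indic A) (indic B) x =
      corr (bal A) (bal B) x + (A.card : ℝ) * B.card / Fintype.card G := by
  rw [corr_indic_left, corr_indic_right, sum_bal, sum_indic]; ring

theorem sum_corr_bal_sq_le (A B : Finset G) :
    ∑ x, corr (bal A) (bal B) x ^ 2 ≤ √(energy A) * √(energy B) := by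
  rw [sum_corr_sq]
  exact (le_abs_self _).trans (sum_mul_le_sqrt _ _ _)

theorem sum_corr_bal_left_sq_le (A : Finset G) (g : G → ℝ) :
    ∑ x, corr (bal A) g x ^ 2 ≤ √(energy A) * (√(Fintype.card G) * ∑ y, g y ^ 2) := by
  rw [sum_corr_sq]
  refine (le_abs_self _).trans ((sum_mul_le_sqrt _ _ _).trans ?_)
  refine mul_le_mul_of_nonneg_left ?_ (Real.sqrt_nonneg _)
  have h0 : 0 ≤ ∑ y, g y ^ 2 := Finset.sum_nonneg fun _ _ => sq_nonneg _
  rw [Real.sqrt_le_iff]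
  refine ⟨by positivity, ?_⟩
  rw [mul_pow, Real.sq_sqrt (Nat.cast_nonneg _)]
  have : ∀ d ∈ (Finset.univ : Finset G), corr g g d ^ 2 ≤ (∑ y, g y ^ 2) ^ 2 := by
    intro d _
    rw [sq_le_sq, abs_of_nonneg h0]
    exact abs_corr_self_le g d
  simpa using Finset.sum_le_sum this

theorem sum_corr_bal_right_sq_le (A : Finset G) (g : G → ℝ) :
    ∑ x, corr g (bal A) x ^ 2 ≤ √(energy A) * (√(Fintype.card G) * ∑ y, g y ^ 2) := by
  refine le_trans (le_of_eq ?_) (sum_corr_bal_left_sq_le A g)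
  refine Fintype.sum_equiv (Equiv.neg G) _ _ fun x => ?_
  simp [corr_neg]

end Energy

section Potential

variable {G : Type*} [AddCommGroup G] [Fintype G] [DecidableEq G]

/-- The total balanced energy of a pair of sets. -/
noncomputable def pot (A B : Finset G) : ℝ := energy A + energy B

/-- A bound for how much the average gain at `x` can fall below zero. -/
noncomputable def loss (A B : Finset G) (x : G) : ℝ :=
  4 * |corr (bal A) (fun y => indic B y * drift B y) x| +
    8 * |corr (fun y => indic A y * drift A y) (bal B) x|

/-- The first order decrease of `pot` when `y` leaves `B` and `±(y - x)` leave `A`. -/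
noncomputable def gain (A B : Finset G) (x y : G) : ℝ := 4 * drift B y + 8 * drift A (y - x)

/-- The points from which fewer than `c` steps in `A` lead to `B`. -/
noncomputable def scarce (A B : Finset G) (c : ℝ) : Finset G :=
  Finset.univ.filter fun x => ((B.filter fun y => y - x ∈ A).card : ℝ) < c

theorem pot_nonneg (A B : Finset G) : 0 ≤ pot A B :=
  add_nonneg (energy_nonneg A) (energy_nonneg B)

theorem loss_nonneg (A B : Finset G) (x : G) : 0 ≤ loss A B x := by unfold loss; positivity

theorem sum_indic_drift_sq_le (S : Finset G) :
    ∑ y, (indic S y * drift S y) ^ 2 ≤ √(Fintype.card G) * √(energy S) ^ 3 := by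
  refine (Finset.sum_le_sum fun y _ => ?_).trans (drift_sq_sum_le S)
  unfold indic; split_ifs
  · simp
  · simpa using sq_nonneg _

theorem sum_loss_sq_le (A B : Finset G) :
    ∑ x, loss A B x ^ 2 ≤ 160 * Fintype.card G * pot A B ^ 2 := by
  have hN := card_pos_real (G := G)
  set N : ℝ := (Fintype.card G : ℝ)
  have hA := energy_nonneg A
  have hB := energy_nonneg B
  have hP := pot_nonneg A B
  have rA : √(energy A) ≤ √(pot A B) := Real.sqrt_le_sqrt (by unfold pot; linarith)
  have rB : √(energy B) ≤ √(pot A B) := Real.sqrt_le_sqrt (by unfold pot; linarith)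
  have key : ∀ u v : ℝ, 0 ≤ u → 0 ≤ v → u ≤ √(pot A B) → v ≤ √(pot A B) →
      u * (√N * (√N * v ^ 3)) ≤ N * pot A B ^ 2 := by
    intro u v hu hv hu' hv'
    have h1 : u * v ^ 3 ≤ √(pot A B) * √(pot A B) ^ 3 := by gcongr
    have h2 : √(pot A B) * √(pot A B) ^ 3 = pot A B ^ 2 := by
      have := Real.sq_sqrt hP
      calc √(pot A B) * √(pot A B) ^ 3 = (√(pot A B) ^ 2) ^ 2 := by ring
        _ = _ := by rw [this]
    calc u * (√N * (√N * v ^ 3)) = (√N * √N) * (u * v ^ 3) := by ring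
      _ = N * (u * v ^ 3) := by rw [Real.mul_self_sqrt hN.le]
      _ ≤ _ := by rw [← h2]; gcongr
  have h1 : ∑ x, corr (bal A) (fun y => indic B y * drift B y) x ^ 2 ≤ N * pot A B ^ 2 := by
    refine (sum_corr_bal_left_sq_le A _).trans (le_trans ?_
      (key _ _ (Real.sqrt_nonneg _) (Real.sqrt_nonneg _) rA rB))
    have := sum_indic_drift_sq_le B
    gcongr
  have h2 : ∑ x, corr (fun y => indic A y * drift A y) (bal B) x ^ 2 ≤ N * pot A B ^ 2 := by
    refine (sum_corr_bal_right_sq_le B _).trans (le_trans ?_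
      (key _ _ (Real.sqrt_nonneg _) (Real.sqrt_nonneg _) rB rA))
    have := sum_indic_drift_sq_le A
    gcongr
  have h3 : ∀ x, loss A B x ^ 2 ≤
      32 * corr (bal A) (fun y => indic B y * drift B y) x ^ 2 +
        128 * corr (fun y => indic A y * drift A y) (bal B) x ^ 2 := by
    intro x
    unfold loss
    generalize corr (bal A) (fun y => indic B y * drift B y) x = a
    generalize corr (fun y => indic A y * drift A y) (bal B) x = b
    rw [← sq_abs a, ← sq_abs b]
    nlinarith [sq_nonneg (4 * |a| - 8 * |b|)]
  refine (Finset.sum_le_sum fun x _ => h3 x).trans ?_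
  rw [Finset.sum_add_distrib, ← Finset.mul_sum, ← Finset.mul_sum]
  linarith

theorem sum_loss_le (A B : Finset G) (S : Finset G) :
    ∑ x ∈ S, loss A B x ≤ 13 * Fintype.card G * pot A B := by
  have hN := card_pos_real (G := G)
  refine (Finset.sum_le_sum_of_subset_of_nonneg (Finset.subset_univ S)
    fun x _ _ => loss_nonneg A B x).trans ?_
  have h1 := Finset.sum_mul_sq_le_sq_mul_sq Finset.univ (fun _ : G => (1 : ℝ)) (loss A B)
  simp only [one_mul, one_pow, Finset.sum_const, Finset.card_univ, nsmul_eq_mul, mul_one] at h1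
  have h2 := sum_loss_sq_le A B
  have hP := pot_nonneg A B
  refine abs_le_of_sq_le_sq' ?_ (by positivity) |>.2
  refine h1.trans ((mul_le_mul_of_nonneg_left h2 hN.le).trans ?_)
  nlinarith [sq_nonneg ((Fintype.card G : ℝ) * pot A B)]

theorem neg_loss_le_sum_gain (A B : Finset G) (x : G) :
    -loss A B x ≤ ∑ y ∈ B.filter (fun y => y - x ∈ A), gain A B x y := by
  have hA := energy_nonneg A
  have hB := energy_nonneg B
  have h1 : ∑ y ∈ B.filter (fun y => y - x ∈ A), drift B y =
      corr (indic A) (fun y => indic B y * drift B y) x := by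
    unfold corr
    rw [Finset.sum_filter, ← sum_indic_mul]
    refine Fintype.sum_equiv (Equiv.subRight x) _ _ fun y => ?_
    simp only [Equiv.subRight_apply, sub_add_cancel]
    unfold indic; split_ifs <;> simp
  have h2 : ∑ y ∈ B.filter (fun y => y - x ∈ A), drift A (y - x) =
      corr (fun y => indic A y * drift A y) (indic B) x := by
    unfold corr
    rw [Finset.sum_filter, ← sum_indic_mul]
    refine Fintype.sum_equiv (Equiv.subRight x) _ _ fun y => ?_
    simp only [Equiv.subRight_apply, sub_add_cancel]
    unfold indic; split_ifs <;> simp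
  unfold gain loss
  rw [Finset.sum_add_distrib, ← Finset.mul_sum, ← Finset.mul_sum, h1, h2, corr_indic_left,
    corr_indic_right, sum_indic_mul, sum_indic_mul, sum_mem_drift, sum_mem_drift]
  have e1 := mul_nonneg (card_div_mem A).1 hB
  have e2 := mul_nonneg (card_div_mem B).1 hA
  have e3 := neg_abs_le (corr (bal A) (fun y => indic B y * drift B y) x)
  have e4 := neg_abs_le (corr (fun y => indic A y * drift A y) (bal B) x)
  linarith

theorem abs_gain_le (A B : Finset G) (x y : G) :
    |gain A B x y| ≤ 12 * √(pot A B * Fintype.card G) := by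
  have hN := card_pos_real (G := G)
  have hA := energy_nonneg A
  have hB := energy_nonneg B
  have rA : √(energy A) ≤ √(pot A B) := Real.sqrt_le_sqrt (by unfold pot; linarith)
  have rB : √(energy B) ≤ √(pot A B) := Real.sqrt_le_sqrt (by unfold pot; linarith)
  have h1 := abs_drift_le B y
  have h2 := abs_drift_le A (y - x)
  rw [Real.sqrt_mul (pot_nonneg A B)]
  have h3 := mul_le_mul_of_nonneg_right rA (Real.sqrt_nonneg (Fintype.card G : ℝ))
  have h4 := mul_le_mul_of_nonneg_right rB (Real.sqrt_nonneg (Fintype.card G : ℝ))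
  unfold gain
  rw [abs_le] at *
  constructor <;> linarith [h1.1, h1.2, h2.1, h2.2]

theorem card_scarce_le {A B : Finset G} {δ : ℝ} (hδ : 0 < δ)
    (hAB : 4 * δ * (Fintype.card G : ℝ) ^ 2 ≤ A.card * B.card) :
    ((scarce A B (2 * δ * Fintype.card G)).card : ℝ) ≤
      pot A B / (4 * δ ^ 2 * (Fintype.card G : ℝ) ^ 2) := by
  have hN := card_pos_real (G := G)
  set N : ℝ := (Fintype.card G : ℝ) with hNdef
  have hA := energy_nonneg A
  have hB := energy_nonneg B
  rw [le_div_iff₀ (by positivity)]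
  have h1 : ∀ x ∈ scarce A B (2 * δ * N), (2 * δ * N) ^ 2 ≤ corr (bal A) (bal B) x ^ 2 := by
    intro x hx
    have hx := (Finset.mem_filter.1 hx).2
    rw [card_filter_eq_corr, corr_indic_indic] at hx
    have : 4 * δ * N ≤ A.card * B.card / N := by
      rw [le_div_iff₀ hN]; linarith
    have h5 : corr (bal A) (bal B) x ≤ -(2 * δ * N) := by linarith
    have h6 : 0 ≤ 2 * δ * N := by positivity
    nlinarith
  have h2 := Finset.sum_le_sum h1
  rw [Finset.sum_const, nsmul_eq_mul] at h2
  have h3 : ∑ x ∈ scarce A B (2 * δ * N), corr (bal A) (bal B) x ^ 2 ≤ pot A B := by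
    refine (Finset.sum_le_sum_of_subset_of_nonneg (Finset.subset_univ _)
      fun x _ _ => sq_nonneg _).trans ((sum_corr_bal_sq_le A B).trans ?_)
    unfold pot
    nlinarith [Real.sq_sqrt hA, Real.sq_sqrt hB, sq_nonneg (√(energy A) - √(energy B))]
  calc _ = ((scarce A B (2 * δ * N)).card : ℝ) * (2 * δ * N) ^ 2 := by ring
    _ ≤ _ := h2.trans h3

theorem exists_step {A B : Finset G} {δ : ℝ} (hδ : 0 < δ)
    (hAB : 4 * δ * (Fintype.card G : ℝ) ^ 2 ≤ A.card * B.card) {x : G}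
    (hx : x ∉ scarce A B (2 * δ * Fintype.card G)) (X : Finset G) {c : ℝ}
    (hX : (X.card : ℝ) ≤ c)
    (hc : c + pot A B / (4 * δ ^ 2 * (Fintype.card G : ℝ) ^ 2) ≤ δ * Fintype.card G)
    {t : ℝ} (ht : 0 ≤ t) :
    ∃ y ∈ B, y - x ∈ A ∧ y ∉ X ∧ y ∉ scarce A B (2 * δ * Fintype.card G) ∧
      t * loss A B y - gain A B x y ≤ loss A B x / (δ * Fintype.card G) +
        12 * √(pot A B * Fintype.card G) *
          (c + pot A B / (4 * δ ^ 2 * (Fintype.card G : ℝ) ^ 2)) / (δ * Fintype.card G) +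
        t * (13 * pot A B / δ) := by
  have hN := card_pos_real (G := G)
  have hP := pot_nonneg A B
  have hsc := card_scarce_le hδ hAB
  set N : ℝ := (Fintype.card G : ℝ) with hNdef
  set bad := scarce A B (2 * δ * N) with hbad
  set b := pot A B / (4 * δ ^ 2 * N ^ 2) with hb
  set R := √(pot A B * N)
  set C0 := B.filter fun y => y - x ∈ A with hC0
  set Z := C0.filter fun y => y ∈ X ∨ y ∈ bad with hZ
  set C := C0.filter fun y => ¬ (y ∈ X ∨ y ∈ bad) with hC
  have hcard0 : 2 * δ * N ≤ C0.card := by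
    simpa [hbad, scarce] using hx
  have hZcard : (Z.card : ℝ) ≤ c + b := by
    have : Z ⊆ X ∪ bad := by
      intro y hy
      rcases (Finset.mem_filter.1 hy).2 with h | h
      · exact Finset.mem_union_left _ h
      · exact Finset.mem_union_right _ h
    have h1 := (Finset.card_le_card this).trans (Finset.card_union_le _ _)
    have h2 : (Z.card : ℝ) ≤ X.card + bad.card := by exact_mod_cast h1
    linarith
  have hsplit : (Z.card : ℝ) + C.card = C0.card := by
    exact_mod_cast Finset.card_filter_add_card_filter_not (s := C0) _
  have hCcard : δ * N ≤ C.card := by linarith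
  have hsumg : ∑ y ∈ Z, gain A B x y + ∑ y ∈ C, gain A B x y = ∑ y ∈ C0, gain A B x y :=
    Finset.sum_filter_add_sum_filter_not _ _ _
  have hZg : ∑ y ∈ Z, gain A B x y ≤ (c + b) * (12 * R) := by
    calc ∑ y ∈ Z, gain A B x y ≤ ∑ y ∈ Z, 12 * R :=
          Finset.sum_le_sum fun y _ => (le_abs_self _).trans (abs_gain_le A B x y)
      _ = Z.card * (12 * R) := by rw [Finset.sum_const, nsmul_eq_mul]
      _ ≤ _ := mul_le_mul_of_nonneg_right hZcard (by positivity)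
  have hg := neg_loss_le_sum_gain A B x
  have hs := sum_loss_le A B C
  have hδN : 0 < δ * N := by positivity
  have hcb : 0 ≤ c + b := (Nat.cast_nonneg _).trans hZcard
  have hsx := loss_nonneg A B x
  set L := loss A B x / (δ * N) + 12 * R * (c + b) / (δ * N) + t * (13 * pot A B / δ) with hL
  have hLeq : L * (δ * N) = loss A B x + 12 * R * (c + b) + t * (13 * N * pot A B) := by
    rw [hL]; field_simp
  have hL0 : 0 ≤ L := by positivity
  have hne : C.Nonempty := by
    rw [← Finset.card_pos]; exact_mod_cast hδN.trans_le hCcard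
  have hsum : ∑ y ∈ C, (t * loss A B y - gain A B x y) ≤ ∑ y ∈ C, L := by
    rw [Finset.sum_const, nsmul_eq_mul, Finset.sum_sub_distrib, ← Finset.mul_sum]
    have h1 : L * (δ * N) ≤ C.card * L := by
      rw [mul_comm]; exact mul_le_mul_of_nonneg_right hCcard hL0
    have h2 := mul_le_mul_of_nonneg_left hs ht
    linarith
  obtain ⟨y, hy, hyL⟩ := Finset.exists_le_of_sum_le hne hsum
  obtain ⟨hy0, hy1⟩ := Finset.mem_filter.1 hy
  obtain ⟨hyB, hyA⟩ := Finset.mem_filter.1 hy0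
  push Not at hy1
  exact ⟨y, hyB, hyA, hy1.1, hy1.2, hyL⟩

end Potential

section Piece

variable {G : Type*} [AddCommGroup G] [Fintype G] [DecidableEq G]

/-- The colours, closed under negation, of the edges from vertices in `P` to their parents. -/
def colours (f : ℕ → G) (par : ℕ → ℕ) (P : Finset ℕ) : Finset G :=
  P.image (fun v => f v - f (par v)) ∪ P.image (fun v => -(f v - f (par v)))

theorem exists_greedy {A B : Finset G} {δ : ℝ} (hδ : 0 < δ)
    (hAB : 4 * δ * (Fintype.card G : ℝ) ^ 2 ≤ A.card * B.card)
    {P : Finset ℕ} {r : ℕ} {par : ℕ → ℕ} (hrP : r ∉ P)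
    (hpar : ∀ v ∈ P, par v < v ∧ (par v = r ∨ par v ∈ P)) {m : ℝ} (hm : (P.card : ℝ) ≤ m)
    (hc : 3 * m + pot A B / (4 * δ ^ 2 * (Fintype.card G : ℝ) ^ 2) ≤ δ * Fintype.card G)
    (d : ℕ → ℝ) (hd : ∀ v, 0 ≤ d v)
    (f₀ : ℕ → G) (hr : f₀ r ∉ scarce A B (2 * δ * Fintype.card G)) (j : ℕ) :
    ∃ f : ℕ → G, (∀ v, v ∉ P → f v = f₀ v) ∧
      (∀ v ∈ P, v < j → f v ∈ B ∧ f v - f (par v) ∈ A ∧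
        f v ∉ scarce A B (2 * δ * Fintype.card G) ∧
        d v / (δ * Fintype.card G) * loss A B (f v) - gain A B (f (par v)) (f v) ≤
          loss A B (f (par v)) / (δ * Fintype.card G) +
          12 * √(pot A B * Fintype.card G) *
            (3 * m + pot A B / (4 * δ ^ 2 * (Fintype.card G : ℝ) ^ 2)) / (δ * Fintype.card G) +
          d v / (δ * Fintype.card G) * (13 * pot A B / δ)) ∧
      (∀ u ∈ P, ∀ v ∈ P, u < v → v < j → f u ≠ f v ∧
        f v - f (par v) ≠ f u - f (par u) ∧ f v - f (par v) ≠ -(f u - f (par u))) := by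
  have hN := card_pos_real (G := G)
  induction j with
  | zero => exact ⟨f₀, fun _ _ => rfl, by simp, by simp⟩
  | succ j ih =>
    obtain ⟨f, hf0, hf1, hf2⟩ := ih
    by_cases hj : j ∈ P
    swap
    · refine ⟨f, hf0, fun v hv hvj => hf1 v hv ?_, fun u hu v hv huv hvj => hf2 u hu v hv huv ?_⟩
      all_goals
        have : v ≠ j := fun h => hj (h ▸ hv)
        omega
    obtain ⟨hpj, hpj'⟩ := hpar j hj
    have hx : f (par j) ∉ scarce A B (2 * δ * Fintype.card G) := by
      rcases hpj' with h | h
      · rw [h, hf0 r hrP]; exact hr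
      · exact (hf1 _ h hpj).2.2.1
    set x := f (par j) with hxdef
    set X := P.image f ∪ (P.image (fun u => x + (f u - f (par u))) ∪
      P.image (fun u => x - (f u - f (par u)))) with hX
    have hXc : (X.card : ℝ) ≤ 3 * m := by
      have h1 : X.card ≤ P.card + (P.card + P.card) :=
        (Finset.card_union_le _ _).trans (add_le_add Finset.card_image_le
          ((Finset.card_union_le _ _).trans
            (add_le_add Finset.card_image_le Finset.card_image_le)))
      have h2 : (X.card : ℝ) ≤ P.card + (P.card + P.card) := by exact_mod_cast h1
      linarith
    obtain ⟨y, hyB, hyA, hyX, hyS, hy⟩ := exists_step hδ hAB hx X hXc hc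
      (div_nonneg (hd j) (by positivity : 0 ≤ δ * (Fintype.card G : ℝ)))
    have hup : ∀ v, v ≠ j → Function.update f j y v = f v := fun v hv => by simp [hv]
    refine ⟨Function.update f j y, fun v hv => ?_, fun v hv hvj => ?_,
      fun u hu v hv huv hvj => ?_⟩
    · rw [hup v (fun h => hv (h ▸ hj)), hf0 v hv]
    · have hpv := (hpar v hv).1
      rw [hup (par v) (by omega)]
      rcases eq_or_ne v j with rfl | hne
      · rw [Function.update_self]
        exact ⟨hyB, hyA, hyS, hy⟩
      · rw [hup v hne]
        exact hf1 v hv (by omega)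
    · have hpv := (hpar v hv).1
      have hpu := (hpar u hu).1
      rw [hup (par v) (by omega), hup (par u) (by omega), hup u (by omega)]
      rcases eq_or_ne v j with rfl | hne
      · rw [Function.update_self]
        simp only [hX, Finset.mem_union, Finset.mem_image, not_or, not_exists, not_and] at hyX
        refine ⟨hyX.1 u hu, fun h => hyX.2.1 u hu ?_, fun h => hyX.2.2 u hu ?_⟩
        · rw [← h]; abel
        · rw [sub_eq_add_neg x, ← h]; abel
      · rw [hup v hne]
        exact hf2 u hu v hv huv (by omega)

theorem mem_colours {f : ℕ → G} {par : ℕ → ℕ} {P : Finset ℕ} {c : G} :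
    c ∈ colours f par P ↔ ∃ v ∈ P, c = f v - f (par v) ∨ c = -(f v - f (par v)) := by
  simp only [colours, Finset.mem_union, Finset.mem_image]
  constructor
  · rintro (⟨v, hv, rfl⟩ | ⟨v, hv, rfl⟩)
    · exact ⟨v, hv, Or.inl rfl⟩
    · exact ⟨v, hv, Or.inr rfl⟩
  · rintro ⟨v, hv, rfl | rfl⟩
    · exact Or.inl ⟨v, hv, rfl⟩
    · exact Or.inr ⟨v, hv, rfl⟩

theorem card_colours_le (f : ℕ → G) (par : ℕ → ℕ) (P : Finset ℕ) :
    (colours f par P).card ≤ 2 * P.card := by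
  unfold colours
  refine (Finset.card_union_le _ _).trans ?_
  have h1 := Finset.card_image_le (s := P) (f := fun v => f v - f (par v))
  have h2 := Finset.card_image_le (s := P) (f := fun v => -(f v - f (par v)))
  omega

theorem exists_piece {A B : Finset G} {δ : ℝ} (hδ : 0 < δ)
    (hAB : 4 * δ * (Fintype.card G : ℝ) ^ 2 ≤ A.card * B.card)
    (hA : ∀ a ∈ A, -a ∈ A) (hA' : ∀ a ∈ A, a ≠ -a)
    {P : Finset ℕ} {r : ℕ} {par : ℕ → ℕ} (hrP : r ∉ P)
    (hpar : ∀ v ∈ P, par v < v ∧ (par v = r ∨ par v ∈ P)) {m : ℝ} (hm : (P.card : ℝ) ≤ m)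
    (hc : 3 * m + pot A B / (4 * δ ^ 2 * (Fintype.card G : ℝ) ^ 2) ≤ δ * Fintype.card G)
    (hpot : pot A B ≤ (Fintype.card G : ℝ) ^ 3)
    (f₀ : ℕ → G) (hr : f₀ r ∉ scarce A B (2 * δ * Fintype.card G))
    {K : ℝ} (hK : loss A B (f₀ r) ≤ K * pot A B) :
    ∃ f : ℕ → G, (∀ v, v ∉ P → f v = f₀ v) ∧
      (∀ v ∈ P, f v ∈ B ∧ f v - f (par v) ∈ A) ∧
      (∀ u ∈ P, ∀ v ∈ P, u ≠ v → f u ≠ f v ∧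
        f v - f (par v) ≠ f u - f (par u) ∧ f v - f (par v) ≠ -(f u - f (par u))) ∧
      pot (A \ colours f par P) (B \ P.image f) ≤ pot A B + P.card *
        ((K / δ + 13 / δ ^ 2 + 3 / δ ^ 3) * pot A B / Fintype.card G +
          (36 / δ + 220) * m * Fintype.card G) := by
  have hN := card_pos_real (G := G)
  have hP := pot_nonneg A B
  obtain ⟨f, hf0, hf1, hf2⟩ := exists_greedy hδ hAB hrP hpar hm hc
    (fun v => ((P.filter fun u => par u = v).card : ℝ)) (fun v => Nat.cast_nonneg _) f₀ hr
    (P.sup id + 1)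
  have hlt : ∀ v ∈ P, v < P.sup id + 1 := fun v hv =>
    Nat.lt_succ_of_le (Finset.le_sup (f := id) hv)
  have hf1 : ∀ v ∈ P, _ := fun v hv => hf1 v hv (hlt v hv)
  have hf2 : ∀ u ∈ P, ∀ v ∈ P, u ≠ v → f u ≠ f v ∧
      f v - f (par v) ≠ f u - f (par u) ∧ f v - f (par v) ≠ -(f u - f (par u)) := by
    intro u hu v hv huv
    rcases huv.lt_or_gt with h | h
    · exact hf2 u hu v hv h (hlt v hv)
    · obtain ⟨h1, h2, h3⟩ := hf2 v hv u hu h (hlt u hu)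
      refine ⟨h1.symm, h2.symm, fun h => h3 ?_⟩
      rw [h, neg_neg]
  refine ⟨f, hf0, fun v hv => ⟨(hf1 v hv).1, (hf1 v hv).2.1⟩, hf2, ?_⟩
  set N : ℝ := (Fintype.card G : ℝ) with hNdef
  set g : ℝ := (P.card : ℝ) with hg
  have hg0 : 0 ≤ g := Nat.cast_nonneg _
  set F := pot A B with hF
  set d : ℕ → ℝ := fun v => ((P.filter fun u => par u = v).card : ℝ) with hd
  have hfr : f r = f₀ r := hf0 r hrP
  -- sizes of the removed sets and the drift sums over them
  have hQB : P.image f ⊆ B := by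
    intro y hy
    obtain ⟨v, hv, rfl⟩ := Finset.mem_image.1 hy
    exact (hf1 v hv).1
  have hQA : colours f par P ⊆ A := by
    intro c hc
    obtain ⟨v, hv, rfl | rfl⟩ := mem_colours.1 hc
    · exact (hf1 v hv).2.1
    · exact hA _ (hf1 v hv).2.1
  have hinj : Set.InjOn f P := by
    intro u hu v hv huv
    by_contra h
    exact (hf2 u hu v hv h).1 huv
  have hinjc : Set.InjOn (fun v => f v - f (par v)) P := by
    intro u hu v hv huv
    by_contra h
    exact (hf2 u hu v hv h).2.1 huv.symm
  have hinjc' : Set.InjOn (fun v => -(f v - f (par v))) P := by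
    intro u hu v hv huv
    exact hinjc hu hv (neg_injective huv)
  have hdisj : Disjoint (P.image fun v => f v - f (par v))
      (P.image fun v => -(f v - f (par v))) := by
    rw [Finset.disjoint_left]
    intro c h1 h2
    obtain ⟨v, hv, rfl⟩ := Finset.mem_image.1 h1
    obtain ⟨u, hu, huv⟩ := Finset.mem_image.1 h2
    rcases eq_or_ne u v with rfl | h
    · exact hA' _ (hf1 u hu).2.1 huv.symm
    · exact (hf2 u hu v hv h).2.2 huv.symm
  have cB : ((P.image f).card : ℝ) = g := by rw [Finset.card_image_of_injOn hinj]
  have cA : ((colours f par P).card : ℝ) ≤ 2 * g := by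
    rw [hg]; exact_mod_cast card_colours_le f par P
  have sB : ∑ y ∈ P.image f, drift B y = ∑ v ∈ P, drift B (f v) := Finset.sum_image hinj
  have sA : ∑ y ∈ colours f par P, drift A y = 2 * ∑ v ∈ P, drift A (f v - f (par v)) := by
    unfold colours
    rw [Finset.sum_union hdisj, Finset.sum_image hinjc, Finset.sum_image hinjc']
    simp only [drift_neg hA]
    ring
  have eB := energy_sdiff_le hQB
  have eA := energy_sdiff_le hQA
  rw [cB, sB] at eB
  rw [sA] at eA
  have cA2 : ((colours f par P).card : ℝ) ^ 2 ≤ (2 * g) ^ 2 := by gcongr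
  have hgain : ∑ v ∈ P, gain A B (f (par v)) (f v) =
      4 * ∑ v ∈ P, drift B (f v) + 8 * ∑ v ∈ P, drift A (f v - f (par v)) := by
    simp only [gain, Finset.sum_add_distrib, Finset.mul_sum]
  have hpot' : pot (A \ colours f par P) (B \ P.image f) ≤
      F - ∑ v ∈ P, gain A B (f (par v)) (f v) + 220 * N * g ^ 2 := by
    rw [hgain, hF]
    change energy _ + energy _ ≤ energy A + energy B - _ + _
    have := mul_le_mul_of_nonneg_left cA2 (by positivity : 0 ≤ 44 * N)
    nlinarith
  -- the telescoping sum of the losses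
  have hfib : ∀ h : ℕ → ℝ, ∑ v ∈ P, h (par v) = d r * h r + ∑ v ∈ P, d v * h v := by
    intro h
    have : ∀ v ∈ P, par v ∈ insert r P := fun v hv => by
      rcases (hpar v hv).2 with h | h
      · simp [h]
      · simp [h]
    rw [← Finset.sum_fiberwise_of_maps_to this (fun v => h (par v)), Finset.sum_insert hrP]
    have e : ∀ u, ∑ v ∈ P with par v = u, h (par v) = d u * h u := by
      intro u
      rw [Finset.sum_congr rfl (g := fun _ => h u)
        (fun v hv => by rw [(Finset.mem_filter.1 hv).2]), Finset.sum_const, nsmul_eq_mul]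
    simp only [e]
  have hdsum : d r + ∑ v ∈ P, d v = g := by
    have := hfib fun _ => 1
    simpa using this.symm
  have hdP : 0 ≤ ∑ v ∈ P, d v := Finset.sum_nonneg fun v _ => Nat.cast_nonneg _
  have hdr : 0 ≤ d r := Nat.cast_nonneg _
  set E := 12 * √(F * N) * (3 * m + F / (4 * δ ^ 2 * N ^ 2)) / (δ * N) with hE
  have hsum : ∑ v ∈ P, (d v / (δ * N) * loss A B (f v) - gain A B (f (par v)) (f v)) ≤
      ∑ v ∈ P, (loss A B (f (par v)) / (δ * N) + E + d v / (δ * N) * (13 * F / δ)) :=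
    Finset.sum_le_sum fun v hv => (hf1 v hv).2.2.2
  rw [Finset.sum_sub_distrib, Finset.sum_add_distrib, Finset.sum_add_distrib,
    Finset.sum_const, nsmul_eq_mul, hfib fun u => loss A B (f u) / (δ * N),
    ← Finset.sum_mul, ← Finset.sum_div] at hsum
  have e1 : ∑ v ∈ P, d v / (δ * N) * loss A B (f v) =
      ∑ v ∈ P, d v * (loss A B (f v) / (δ * N)) :=
    Finset.sum_congr rfl fun v _ => by ring
  rw [e1, hfr] at hsum
  have hloss : d r * (loss A B (f₀ r) / (δ * N)) ≤ g * (K * F / (δ * N)) := by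
    have h1 : loss A B (f₀ r) / (δ * N) ≤ K * F / (δ * N) := by gcongr
    have h0 : 0 ≤ loss A B (f₀ r) / (δ * N) := div_nonneg (loss_nonneg _ _ _) (by positivity)
    have : d r ≤ g := by linarith
    exact mul_le_mul this h1 h0 hg0
  have hlast : (∑ v ∈ P, d v) / (δ * N) * (13 * F / δ) ≤ g / (δ * N) * (13 * F / δ) := by
    have : ∑ v ∈ P, d v ≤ g := by linarith
    gcongr
  have hR : √(F * N) ≤ N ^ 2 := by
    rw [Real.sqrt_le_iff]
    refine ⟨by positivity, ?_⟩
    calc F * N ≤ N ^ 3 * N := by gcongr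
      _ = _ := by ring
  have hm0 : 0 ≤ m := hg0.trans hm
  have hE' : E ≤ 36 / δ * m * N + 3 / δ ^ 3 * F / N := by
    calc E ≤ 12 * N ^ 2 * (3 * m + F / (4 * δ ^ 2 * N ^ 2)) / (δ * N) := by
          rw [hE]; gcongr
      _ = _ := by field_simp; ring
  have hgE : g * E ≤ g * (36 / δ * m * N + 3 / δ ^ 3 * F / N) := by gcongr
  have hgg : 220 * N * g ^ 2 ≤ 220 * N * (g * m) := by
    rw [sq]; gcongr
  have id1 : g * (K * F / (δ * N)) = g * (K / δ * F / N) := by field_simp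
  have id2 : g / (δ * N) * (13 * F / δ) = g * (13 / δ ^ 2 * F / N) := by field_simp
  have id3 : F + g * ((K / δ + 13 / δ ^ 2 + 3 / δ ^ 3) * F / N + (36 / δ + 220) * m * N) =
      F + g * (K / δ * F / N) + g * (13 / δ ^ 2 * F / N) +
        g * (36 / δ * m * N + 3 / δ ^ 3 * F / N) + 220 * N * (g * m) := by ring
  rw [id3]
  linarith

end Piece

section Cutting

/-- The last vertex reached from `v` by moving to parents outside of `W`. -/
def topOf (par : ℕ → ℕ) (W : Finset ℕ) (v : ℕ) : ℕ :=
  if _h : par v < v ∧ par v ∉ W then topOf par W (par v) else v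
termination_by v

theorem topOf_of_mem {par : ℕ → ℕ} {W : Finset ℕ} {v : ℕ} (h : par v ∈ W) :
    topOf par W v = v := by
  rw [topOf]; simp [h]

theorem topOf_of_notMem {par : ℕ → ℕ} {W : Finset ℕ} {v : ℕ} (h : par v ∉ W)
    (hv : par v < v) : topOf par W v = topOf par W (par v) := by
  rw [topOf]; simp [h, hv]

theorem topOf_spec {par : ℕ → ℕ} {W : Finset ℕ} (h0 : 0 ∈ W)
    (hpar : ∀ v, v ≠ 0 → par v < v) (v : ℕ) (hv : v ∉ W) :
    topOf par W v ∉ W ∧ par (topOf par W v) ∈ W ∧ topOf par W v ≤ v := by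
  induction v using Nat.strong_induction_on with
  | _ v ih =>
    have hlt : par v < v := hpar v fun h => hv (h ▸ h0)
    by_cases h : par v ∈ W
    · rw [topOf_of_mem h]; exact ⟨hv, h, le_rfl⟩
    · rw [topOf_of_notMem h hlt]
      obtain ⟨h1, h2, h3⟩ := ih _ hlt h
      exact ⟨h1, h2, h3.trans hlt.le⟩

theorem exists_iterate_eq_topOf {par : ℕ → ℕ} {W : Finset ℕ} (v : ℕ) (hv : v ∉ W) :
    ∃ i, par^[i] v = topOf par W v ∧ ∀ k ≤ i, par^[k] v ∉ W := by
  induction v using Nat.strong_induction_on with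
  | _ v ih =>
    by_cases h : par v < v ∧ par v ∉ W
    · obtain ⟨i, h1, h2⟩ := ih _ h.1 h.2
      refine ⟨i + 1, ?_, fun k hk => ?_⟩
      · rw [topOf_of_notMem h.2 h.1, ← h1, Function.iterate_succ_apply]
      · rcases k with _ | k
        · simpa using hv
        · rw [Function.iterate_succ_apply]; exact h2 k (by omega)
    · refine ⟨0, ?_, fun k hk => ?_⟩
      · rw [topOf]; simp [h]
      · obtain rfl : k = 0 := by omega
        simpa using hv

theorem iterate_par_le {par : ℕ → ℕ} (hpar : ∀ v, par v ≤ v) (i v : ℕ) : par^[i] v ≤ v := by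
  induction i generalizing v with
  | zero => simp
  | succ i ih => rw [Function.iterate_succ_apply]; exact (ih _).trans (hpar v)

open Classical in
theorem exists_cut_aux {par : ℕ → ℕ} (hpar : ∀ v, par v ≤ v) (m : ℕ) (hm : 0 < m) (S : Finset ℕ)
    (hS : ∀ v ∈ S, par v ∈ S) :
    ∃ W ⊆ S, W.card * m ≤ S.card ∧ ∀ r,
      (S.filter fun u => ∃ i, par^[i] u = r ∧ ∀ k ≤ i, par^[k] u ∉ W).card ≤ m := by
  induction hs : S.card using Nat.strong_induction_on generalizing S with
  | _ s ih =>
    subst hs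
    set sub : ℕ → Finset ℕ := fun v => S.filter fun u => ∃ i, par^[i] u = v with hsub
    by_cases hbig : ∃ v ∈ S, m < (sub v).card
    swap
    · push Not at hbig
      refine ⟨∅, by simp, by simp, fun r => ?_⟩
      by_cases hr : r ∈ S
      · refine (Finset.card_le_card fun u hu => ?_).trans (hbig r hr)
        obtain ⟨h1, i, h2, -⟩ := Finset.mem_filter.1 hu
        exact Finset.mem_filter.2 ⟨h1, i, h2⟩
      · rw [Finset.card_eq_zero.2]
        · omega
        · refine Finset.filter_eq_empty_iff.2 fun {u} hu => ?_
          rintro ⟨i, rfl, -⟩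
          refine hr ?_
          clear hr
          induction i with
          | zero => simpa using hu
          | succ i ih => rw [Function.iterate_succ_apply']; exact hS _ ih
    · have hne : (S.filter fun v => m < (sub v).card).Nonempty := by
        obtain ⟨v, hv, h⟩ := hbig
        exact ⟨v, Finset.mem_filter.2 ⟨hv, h⟩⟩
      obtain ⟨v, hvmem, hvmax⟩ := Finset.exists_max_image _ id hne
      obtain ⟨hvS, hvm⟩ := Finset.mem_filter.1 hvmem
      have hsubS : sub v ⊆ S := Finset.filter_subset _ _
      have hcard : (S \ sub v).card + (sub v).card = S.card :=
        Finset.card_sdiff_add_card_eq_card hsubS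
      obtain ⟨W, hWS, hWc, hWp⟩ := ih (S \ sub v).card (by omega) (S \ sub v) (by
        intro u hu
        obtain ⟨h1, h2⟩ := Finset.mem_sdiff.1 hu
        refine Finset.mem_sdiff.2 ⟨hS u h1, fun h => h2 ?_⟩
        obtain ⟨-, i, hi⟩ := Finset.mem_filter.1 h
        exact Finset.mem_filter.2 ⟨h1, i + 1, by rw [Function.iterate_succ_apply]; exact hi⟩) rfl
      refine ⟨insert v W, ?_, ?_, fun r => ?_⟩
      · exact Finset.insert_subset hvS (hWS.trans Finset.sdiff_subset)
      · have h1 := Finset.card_insert_le v W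
        have h2 : (insert v W).card * m ≤ (W.card + 1) * m := Nat.mul_le_mul_right m h1
        rw [Nat.succ_mul] at h2
        omega
      · by_cases hr : r ∈ sub v
        · rcases eq_or_ne r v with rfl | hrv
          · rw [Finset.card_eq_zero.2]
            · omega
            · refine Finset.filter_eq_empty_iff.2 fun {u} hu => ?_
              rintro ⟨i, hi, h⟩
              exact h i le_rfl (by simp [hi])
          · obtain ⟨hrS, i, hi⟩ := Finset.mem_filter.1 hr
            have hlt : v < r := lt_of_le_of_ne (hi ▸ iterate_par_le hpar i r) hrv.symm
            have : (sub r).card ≤ m := by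
              by_contra hcon
              have := hvmax r (Finset.mem_filter.2 ⟨hrS, by omega⟩)
              simp only [id] at this
              omega
            refine (Finset.card_le_card fun u hu => ?_).trans this
            obtain ⟨h1, j, h2, -⟩ := Finset.mem_filter.1 hu
            exact Finset.mem_filter.2 ⟨h1, j, h2⟩
        · refine (Finset.card_le_card fun u hu => ?_).trans (hWp r)
          obtain ⟨h1, i, h2, h3⟩ := Finset.mem_filter.1 hu
          refine Finset.mem_filter.2 ⟨Finset.mem_sdiff.2 ⟨h1, fun hu' => ?_⟩, i, h2,
            fun k hk h => h3 k hk (Finset.mem_insert_of_mem h)⟩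
          obtain ⟨-, j, hj⟩ := Finset.mem_filter.1 hu'
          rcases le_or_gt j i with hji | hij
          · exact h3 j hji (by simp [hj])
          · refine hr (Finset.mem_filter.2 ⟨?_, j - i, ?_⟩)
            · rw [← h2]
              clear h2 h3 hij
              induction i with
              | zero => simpa using h1
              | succ i ih => rw [Function.iterate_succ_apply']; exact hS _ ih
            · rw [← h2, ← Function.iterate_add_apply, Nat.sub_add_cancel hij.le, hj]

theorem exists_cut (n : ℕ) {par : ℕ → ℕ} (hpar : ∀ v, v ≠ 0 → par v < v) {m : ℕ} (hm : 0 < m) :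
    ∃ W ⊆ Finset.range (n + 1), 0 ∈ W ∧ W.card * m ≤ n + 1 + m ∧ ∀ r,
      ((Finset.range (n + 1)).filter fun u => u ∉ W ∧ topOf par W u = r).card ≤ m := by
  classical
  set p : ℕ → ℕ := fun v => if v = 0 then 0 else par v with hp
  have hp' : ∀ v, p v ≤ v := by
    intro v
    by_cases h : v = 0
    · simp [hp, h]
    · simpa [hp, h] using (hpar v h).le
  obtain ⟨W, hW, hc, hr⟩ := exists_cut_aux hp' m hm (Finset.range (n + 1)) (by
    intro v hv
    simp only [Finset.mem_range] at hv ⊢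
    have := hp' v
    omega)
  refine ⟨insert 0 W, Finset.insert_subset (by simp) hW, by simp, ?_, fun r => ?_⟩
  · have h2 : (insert 0 W).card * m ≤ (W.card + 1) * m :=
      Nat.mul_le_mul_right m (Finset.card_insert_le 0 W)
    rw [Nat.succ_mul] at h2
    rw [Finset.card_range] at hc
    omega
  · refine (Finset.card_le_card fun u hu => ?_).trans (hr r)
    obtain ⟨h1, h2, h3⟩ := Finset.mem_filter.1 hu
    obtain ⟨i, hi, hk⟩ := exists_iterate_eq_topOf (par := par) u h2
    have key : ∀ k ≤ i, p^[k] u = par^[k] u := by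
      intro k
      induction k with
      | zero => simp
      | succ k ih =>
        intro hki
        rw [Function.iterate_succ_apply', Function.iterate_succ_apply', ih (by omega)]
        have : par^[k] u ≠ 0 := fun h => hk k (by omega) (by simp [h])
        simp [hp, this]
    exact Finset.mem_filter.2 ⟨h1, i, by rw [key i le_rfl, hi, h3],
      fun k hki h => hk k hki (Finset.mem_insert_of_mem (key k hki ▸ h))⟩

end Cutting

section Global

/-- The vertices of `D` which, like their parents, lie outside of `W`. -/
def innerPart (par : ℕ → ℕ) (W D : Finset ℕ) : Finset ℕ := D.filter fun v => v ∉ W ∧ par v ∉ W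

/-- The role of a vertex: `0` on `W`, `3` on inner vertices; the remaining vertices have role
`2` on `L` and role `1` outside of `L`. -/
def role (par : ℕ → ℕ) (W L : Finset ℕ) (v : ℕ) : ℕ :=
  if v ∈ W then 0 else if par v ∈ W then (if v ∈ L then 2 else 1) else 3

/-- The piece with a given top vertex. -/
def piece (n : ℕ) (par : ℕ → ℕ) (W : Finset ℕ) (r : ℕ) : Finset ℕ :=
  (Finset.range (n + 1)).filter fun u => u ∉ W ∧ topOf par W u = r

variable {G : Type*} [AddCommGroup G] [Fintype G] [DecidableEq G]

variable (G) in
/-- The data for embedding a tree with vertices `0, …, n` into `G` with all edge colours distinct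
up to sign. -/
structure Plan where
  n : ℕ
  par : ℕ → ℕ
  W : Finset ℕ
  posreg : G → ℕ
  colreg : G → ℕ
  A₀ : Finset G
  B₀ : Finset G
  m : ℝ
  δ : ℝ
  K : ℝ
  Φ : ℝ
  β : ℝ
  a : ℝ
  b : ℝ
  par_lt : ∀ v, v ≠ 0 → par v < v
  zero_mem : 0 ∈ W
  W_sub : W ⊆ Finset.range (n + 1)
  piece_le : ∀ r, ((piece n par W r).card : ℝ) ≤ m
  n_le : n ≤ Fintype.card G
  A_neg : ∀ c ∈ A₀, -c ∈ A₀
  A_ne : ∀ c ∈ A₀, c ≠ -c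
  A_reg : ∀ c ∈ A₀, colreg c = 3
  B_reg : ∀ y ∈ B₀, posreg y = 3
  colreg_neg : ∀ c, colreg (-c) = colreg c
  δ_pos : 0 < δ
  K_pos : 0 < K
  a_nonneg : 0 ≤ a
  b_nonneg : 0 ≤ b
  A_large : a + 2 * (innerPart par W (Finset.range (n + 1))).card ≤ A₀.card
  B_large : b + (innerPart par W (Finset.range (n + 1))).card ≤ B₀.card
  ab_large : 4 * δ * (Fintype.card G : ℝ) ^ 2 ≤ a * b
  pot_small : Real.exp (K / δ + 13 / δ ^ 2 + 3 / δ ^ 3) *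
    (pot A₀ B₀ + (36 / δ + 220) * m * (Fintype.card G : ℝ) * Fintype.card G) ≤ Φ
  Φ_le : Φ ≤ (Fintype.card G : ℝ) ^ 3
  m_small : 3 * m + Φ / (4 * δ ^ 2 * (Fintype.card G : ℝ) ^ 2) ≤ δ * Fintype.card G
  β_large : Φ / (4 * δ ^ 2 * (Fintype.card G : ℝ) ^ 2) + 13 * Fintype.card G / K ≤ β
  exists_hub : ∀ x, 3 * W.card <
    (Finset.univ.filter fun y => posreg y = 0 ∧ colreg (y - x) = 0).card
  exists_link : ∀ x, posreg x = 0 → 3 * (W.card + β) + β <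
    (Finset.univ.filter fun y => posreg y = 2 ∧ colreg (y - x) = 2).card
  exists_star : ∀ x : ℕ → G, (∀ w ∈ W, posreg (x w) = 0) →
    (∀ u ∈ W, ∀ v ∈ W, u ≠ v → x u ≠ x v) →
    ∃ σ : ℕ → G, ∀ r ∈ Finset.range (n + 1), r ∉ W → par r ∈ W →
      posreg (σ r) = 1 ∧ colreg (σ r - x (par r)) = 1 ∧
      ∀ u ∈ Finset.range (n + 1), u ∉ W → par u ∈ W → u ≠ r → σ u ≠ σ r ∧
        σ r - x (par r) ≠ σ u - x (par u) ∧ σ r - x (par r) ≠ -(σ u - x (par u))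

theorem pot_bound_step {c e F F₀ g q N : ℝ} (hc : 0 ≤ c) (he : 0 ≤ e) (hF : 0 ≤ F)
    (hg : 0 ≤ g) (hq : 0 ≤ q) (hN : 0 < N) (h : F ≤ Real.exp (c * g / N) * (F₀ + e * g)) :
    F + q * (c * F / N + e) ≤ Real.exp (c * (g + q) / N) * (F₀ + e * (g + q)) := by
  have e1 : F + q * (c * F / N + e) = (1 + c * q / N) * F + q * e := by
    field_simp; ring
  have e2 : 1 + c * q / N ≤ Real.exp (c * q / N) := by
    have := Real.add_one_le_exp (c * q / N); linarith
  have e3 : (1 + c * q / N) * F ≤ Real.exp (c * q / N) *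
      (Real.exp (c * g / N) * (F₀ + e * g)) :=
    mul_le_mul e2 h hF (Real.exp_nonneg _)
  have e4 : Real.exp (c * (g + q) / N) = Real.exp (c * q / N) * Real.exp (c * g / N) := by
    rw [← Real.exp_add]; congr 1; ring
  have e5 : q * e ≤ Real.exp (c * q / N) * Real.exp (c * g / N) * (q * e) := by
    refine le_mul_of_one_le_left (by positivity) ?_
    rw [← Real.exp_add]
    exact Real.one_le_exp (by positivity)
  rw [e1, e4]
  calc _ ≤ _ := add_le_add e3 e5
    _ = _ := by ring

/-- An embedding of a part of the tree together with the colours `A` and the points `B` which are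
still free. -/
structure Plan.State (p : Plan G) (D L : Finset ℕ) (f : ℕ → G) (A B : Finset G) : Prop where
  sub : D ⊆ Finset.range (p.n + 1)
  par_mem : ∀ v ∈ D, v ≠ 0 → p.par v ∈ D
  piece_sub : ∀ v ∈ D, v ∉ p.W → piece p.n p.par p.W (topOf p.par p.W v) ⊆ D
  inj : ∀ u ∈ D, ∀ v ∈ D, u ≠ v → f u ≠ f v
  col : ∀ u ∈ D, ∀ v ∈ D, u ≠ 0 → v ≠ 0 → u ≠ v →
    f v - f (p.par v) ≠ f u - f (p.par u) ∧ f v - f (p.par v) ≠ -(f u - f (p.par u))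
  pos_role : ∀ v ∈ D, p.posreg (f v) = role p.par p.W L v
  col_role : ∀ v ∈ D, v ≠ 0 → p.colreg (f v - f (p.par v)) = role p.par p.W L v
  L_sub : L ⊆ D
  A_sub : A ⊆ p.A₀
  A_neg : ∀ c ∈ A, -c ∈ A
  B_sub : B ⊆ p.B₀
  A_free : ∀ v ∈ D, v ≠ 0 → f v - f (p.par v) ∉ A
  B_free : ∀ v ∈ D, f v ∉ B
  A_card : p.A₀.card ≤ A.card + 2 * (innerPart p.par p.W D).card
  B_card : p.B₀.card ≤ B.card + (innerPart p.par p.W D).card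
  pot_le : pot A B ≤
    Real.exp ((p.K / p.δ + 13 / p.δ ^ 2 + 3 / p.δ ^ 3) * (innerPart p.par p.W D).card /
      Fintype.card G) *
    (pot p.A₀ p.B₀ + (36 / p.δ + 220) * p.m * (Fintype.card G : ℝ) * (innerPart p.par p.W D).card)

namespace Plan

variable {p : Plan G} {D L : Finset ℕ} {f : ℕ → G} {A B : Finset G}

theorem m_nonneg (p : Plan G) : 0 ≤ p.m := (Nat.cast_nonneg _).trans (p.piece_le 0)

theorem State.inner_card_le (h : p.State D L f A B) :
    (innerPart p.par p.W D).card ≤ (innerPart p.par p.W (Finset.range (p.n + 1))).card :=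
  Finset.card_le_card (Finset.filter_subset_filter _ h.sub)

theorem State.inner_card_le_card (h : p.State D L f A B) :
    ((innerPart p.par p.W D).card : ℝ) ≤ Fintype.card G := by
  have h1 : innerPart p.par p.W D ⊆ (Finset.range (p.n + 1)).erase 0 := by
    intro v hv
    obtain ⟨h1, h2, h3⟩ := Finset.mem_filter.1 hv
    exact Finset.mem_erase.2 ⟨fun h0 => h2 (h0 ▸ p.zero_mem), h.sub h1⟩
  have h2 := Finset.card_le_card h1
  rw [Finset.card_erase_of_mem (by simp), Finset.card_range] at h2
  exact_mod_cast h2.trans p.n_le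

theorem State.pot_le_Φ (h : p.State D L f A B) : pot A B ≤ p.Φ := by
  have hN := card_pos_real (G := G)
  have hδ := p.δ_pos
  have hK := p.K_pos
  have hm := p.m_nonneg
  have hP := pot_nonneg p.A₀ p.B₀
  have hg := h.inner_card_le_card
  refine h.pot_le.trans (le_trans ?_ p.pot_small)
  gcongr
  rw [mul_div_assoc]
  refine mul_le_of_le_one_right (by positivity) ?_
  rwa [div_le_one hN]

theorem State.mul_card_ge (h : p.State D L f A B) :
    4 * p.δ * (Fintype.card G : ℝ) ^ 2 ≤ A.card * B.card := by
  have h1 : ((innerPart p.par p.W D).card : ℝ) ≤ _ := Nat.cast_le.2 h.inner_card_le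
  have h2 := p.A_large
  have h3 := p.B_large
  have h4 : (p.A₀.card : ℝ) ≤ A.card + 2 * (innerPart p.par p.W D).card := by
    exact_mod_cast h.A_card
  have h5 : (p.B₀.card : ℝ) ≤ B.card + (innerPart p.par p.W D).card := by exact_mod_cast h.B_card
  have h6 : p.a ≤ A.card := by linarith
  have h7 : p.b ≤ B.card := by linarith
  exact p.ab_large.trans (mul_le_mul h6 h7 p.b_nonneg (Nat.cast_nonneg _))

theorem State.small (h : p.State D L f A B) :
    3 * p.m + pot A B / (4 * p.δ ^ 2 * (Fintype.card G : ℝ) ^ 2) ≤ p.δ * Fintype.card G := by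
  have hN := card_pos_real (G := G)
  have hδ := p.δ_pos
  have h1 := h.pot_le_Φ
  refine le_trans ?_ p.m_small
  gcongr

/-- The points which are unsuitable as positions of the top vertex of a piece. -/
noncomputable def bad (p : Plan G) (A B : Finset G) : Finset G :=
  scarce A B (2 * p.δ * Fintype.card G) ∪
    Finset.univ.filter fun y => p.K * pot A B < loss A B y

theorem State.card_bad_le (h : p.State D L f A B) : ((p.bad A B).card : ℝ) ≤ p.β := by
  have hN := card_pos_real (G := G)
  have hδ := p.δ_pos
  have hK := p.K_pos
  have hP := pot_nonneg A B
  have h1 := card_scarce_le hδ h.mul_card_ge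
  have h2 : pot A B / (4 * p.δ ^ 2 * (Fintype.card G : ℝ) ^ 2) ≤
      p.Φ / (4 * p.δ ^ 2 * (Fintype.card G : ℝ) ^ 2) := by
    have := h.pot_le_Φ
    gcongr
  set S := Finset.univ.filter fun y => p.K * pot A B < loss A B y with hS
  have h3 : (S.card : ℝ) ≤ 13 * Fintype.card G / p.K := by
    rw [le_div_iff₀ hK]
    have hs := sum_loss_le A B S
    have hs' : ∑ y ∈ S, p.K * pot A B ≤ ∑ y ∈ S, loss A B y :=
      Finset.sum_le_sum fun y hy => (Finset.mem_filter.1 hy).2.le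
    rcases hP.eq_or_lt with h0 | h0
    · have : S = ∅ := by
        by_contra hne
        obtain ⟨y, hy⟩ := Finset.nonempty_iff_ne_empty.2 hne
        have hlt := (Finset.mem_filter.1 hy).2
        have hle := Finset.single_le_sum (fun y _ => loss_nonneg A B y) hy
        rw [← h0] at hs hlt
        simp only [mul_zero] at hs hlt
        linarith
      rw [this]; simp
    · rw [Finset.sum_const, nsmul_eq_mul] at hs'
      have : S.card * p.K * pot A B ≤ 13 * Fintype.card G * pot A B := by linarith
      exact le_of_mul_le_mul_right this h0
  have h4 : ((p.bad A B).card : ℝ) ≤ (scarce A B (2 * p.δ * Fintype.card G)).card + S.card := by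
    exact_mod_cast Finset.card_union_le _ _
  linarith [p.β_large]

theorem role_insert {par : ℕ → ℕ} {W L : Finset ℕ} {r v : ℕ} (h : v ≠ r) :
    role par W (insert r L) v = role par W L v := by
  simp [role, h]

theorem State.exists_add_piece (h : p.State D L f A B) {r : ℕ}
    (hr : r ∈ Finset.range (p.n + 1)) (hrW : r ∉ p.W) (hprW : p.par r ∈ p.W) (hrD : r ∉ D)
    (hprD : p.par r ∈ D) {L' : Finset ℕ} (hL' : L' = L ∨ L' = insert r L) {y : G}
    (hy : y ∉ p.bad A B) (hpos : p.posreg y = role p.par p.W L' r)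
    (hcol : p.colreg (y - f (p.par r)) = role p.par p.W L' r)
    (hfresh : ∀ v ∈ D, role p.par p.W L v = role p.par p.W L' r → f v ≠ y ∧
      (v ≠ 0 → y - f (p.par r) ≠ f v - f (p.par v) ∧
        y - f (p.par r) ≠ -(f v - f (p.par v)))) :
    ∃ f' A' B', p.State (D ∪ piece p.n p.par p.W r) L' f' A' B' ∧ (∀ v ∈ D, f' v = f v) ∧
      f' r = y := by
  classical
  have hN := card_pos_real (G := G)
  have hpar := p.par_lt
  have hr0 : r ≠ 0 := fun h0 => hrW (h0 ▸ p.zero_mem)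
  have htop : topOf p.par p.W r = r := topOf_of_mem hprW
  set C := piece p.n p.par p.W r with hC
  have hrC : r ∈ C := Finset.mem_filter.2 ⟨hr, hrW, htop⟩
  have hCW : ∀ v ∈ C, v ∉ p.W := fun v hv => (Finset.mem_filter.1 hv).2.1
  have hCtop : ∀ v ∈ C, topOf p.par p.W v = r := fun v hv => (Finset.mem_filter.1 hv).2.2
  have hC0 : ∀ v ∈ C, v ≠ 0 := fun v hv h0 => hCW v hv (h0 ▸ p.zero_mem)
  have hCD : ∀ v ∈ C, v ∉ D := by
    intro v hv hvD
    have := h.piece_sub v hvD (hCW v hv)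
    rw [hCtop v hv] at this
    exact hrD (this hrC)
  set P := C.erase r with hPdef
  have hPC : ∀ v ∈ P, v ∈ C := fun v hv => Finset.mem_of_mem_erase hv
  have hP : ∀ v ∈ P, p.par v ∉ p.W ∧ p.par v ∈ C := by
    intro v hv
    have hvC := hPC v hv
    have h1 : p.par v ∉ p.W := fun hw => by
      have := hCtop v hvC
      rw [topOf_of_mem hw] at this
      exact Finset.ne_of_mem_erase hv this
    refine ⟨h1, Finset.mem_filter.2 ⟨?_, h1, ?_⟩⟩
    · have h2 := (Finset.mem_filter.1 hvC).1
      have h3 := hpar v (hC0 v hvC)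
      simp only [Finset.mem_range] at h2 ⊢
      omega
    · rw [← topOf_of_notMem h1 (hpar v (hC0 v hvC))]; exact hCtop v hvC
  have hDP : ∀ v ∈ D, v ∉ P ∧ v ≠ r := fun v hv =>
    ⟨fun hvP => hCD v (hPC v hvP) hv, fun e => hrD (e ▸ hv)⟩
  have hybad : y ∉ scarce A B (2 * p.δ * Fintype.card G) ∧ loss A B y ≤ p.K * pot A B := by
    simpa [bad] using hy
  have hA₀ : ∀ a ∈ A, a ≠ -a := fun a ha => p.A_ne a (h.A_sub ha)
  have hPm : (P.card : ℝ) ≤ p.m := by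
    refine le_trans ?_ (p.piece_le r)
    exact_mod_cast Finset.card_le_card (Finset.erase_subset _ _)
  obtain ⟨f', hf0, hf1, hf2, hpot⟩ := exists_piece p.δ_pos h.mul_card_ge h.A_neg hA₀
    (Finset.notMem_erase r C) (par := p.par)
    (fun v hv => ⟨hpar v (hC0 v (hPC v hv)), by
      rcases eq_or_ne (p.par v) r with e | e
      · exact Or.inl e
      · exact Or.inr (Finset.mem_erase.2 ⟨e, (hP v hv).2⟩)⟩)
    hPm h.small (h.pot_le_Φ.trans p.Φ_le) (Function.update f r y)
    (by rw [Function.update_self]; exact hybad.1) (K := p.K)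
    (by rw [Function.update_self]; exact hybad.2)
  change ∀ u ∈ P, ∀ v ∈ P, _ at hf2
  change ∀ v ∈ P, _ at hf1
  change ∀ v, v ∉ P → _ at hf0
  have hfD : ∀ v ∈ D, f' v = f v := by
    intro v hv
    rw [hf0 v (hDP v hv).1, Function.update_of_ne (hDP v hv).2]
  have hfr : f' r = y := by rw [hf0 r (Finset.notMem_erase r C), Function.update_self]
  have hfpr : f' (p.par r) = f (p.par r) := hfD _ hprD
  have hfDpar : ∀ v ∈ D, v ≠ 0 → f' (p.par v) = f (p.par v) := fun v hv h0 =>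
    hfD _ (h.par_mem v hv h0)
  have hmem : ∀ v, v ∈ D ∪ C ↔ v ∈ D ∨ v = r ∨ v ∈ P := by
    intro v
    rw [Finset.mem_union, hPdef, Finset.mem_erase]
    constructor
    · rintro (h | h)
      · exact Or.inl h
      · by_cases e : v = r
        · exact Or.inr (Or.inl e)
        · exact Or.inr (Or.inr ⟨e, h⟩)
    · rintro (h | rfl | h)
      · exact Or.inl h
      · exact Or.inr hrC
      · exact Or.inr h.2
  have hroleD : ∀ v ∈ D, role p.par p.W L' v = role p.par p.W L v := by
    intro v hv
    rcases hL' with rfl | rfl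
    · rfl
    · exact role_insert (hDP v hv).2
  have hroleP : ∀ v ∈ P, role p.par p.W L' v = 3 := fun v hv => by
    simp [role, hCW v (hPC v hv), (hP v hv).1]
  have hrole_r : role p.par p.W L' r ≠ 3 := by
    unfold role; rw [if_neg hrW, if_pos hprW]; split_ifs <;> simp
  have hposP : ∀ v ∈ P, p.posreg (f' v) = 3 := fun v hv => p.B_reg _ (h.B_sub (hf1 v hv).1)
  have hcolP : ∀ v ∈ P, p.colreg (f' v - f' (p.par v)) = 3 := fun v hv =>
    p.A_reg _ (h.A_sub (hf1 v hv).2)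
  have hposD : ∀ v ∈ D, p.posreg (f' v) = role p.par p.W L v := fun v hv => by
    rw [hfD v hv]; exact h.pos_role v hv
  have hcolD : ∀ v ∈ D, v ≠ 0 → p.colreg (f' v - f' (p.par v)) = role p.par p.W L v :=
    fun v hv h0 => by rw [hfD v hv, hfDpar v hv h0]; exact h.col_role v hv h0
  have hcolr : p.colreg (f' r - f' (p.par r)) = role p.par p.W L' r := by
    rw [hfr, hfpr]; exact hcol
  -- injectivity, one order of each pair
  have hinjDr : ∀ v ∈ D, f' v ≠ f' r := by
    intro v hv e
    have h1 := hposD v hv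
    rw [e, hfr, hpos] at h1
    refine (hfresh v hv h1.symm).1 ?_
    rw [← hfD v hv, e, hfr]
  have hinjDP : ∀ v ∈ D, ∀ u ∈ P, f' v ≠ f' u := by
    intro v hv u hu e
    refine h.B_free v hv ?_
    rw [← hfD v hv, e]
    exact (hf1 u hu).1
  have hinjrP : ∀ u ∈ P, f' r ≠ f' u := by
    intro u hu e
    have h1 := hposP u hu
    rw [← e, hfr, hpos] at h1
    exact hrole_r h1
  have hcolDr : ∀ v ∈ D, v ≠ 0 → f' r - f' (p.par r) ≠ f' v - f' (p.par v) ∧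
      f' r - f' (p.par r) ≠ -(f' v - f' (p.par v)) := by
    intro v hv h0
    have h1 := hcolD v hv h0
    constructor
    · intro e
      rw [← e, hcolr] at h1
      refine ((hfresh v hv h1.symm).2 h0).1 ?_
      rw [← hfD v hv, ← hfDpar v hv h0, ← e, hfr, hfpr]
    · intro e
      rw [← p.colreg_neg, ← e, hcolr] at h1
      refine ((hfresh v hv h1.symm).2 h0).2 ?_
      rw [← hfD v hv, ← hfDpar v hv h0, ← e, hfr, hfpr]
  have hcolDP : ∀ v ∈ D, v ≠ 0 → ∀ u ∈ P, f' u - f' (p.par u) ≠ f' v - f' (p.par v) ∧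
      f' u - f' (p.par u) ≠ -(f' v - f' (p.par v)) := by
    intro v hv h0 u hu
    have h1 := h.A_free v hv h0
    rw [← hfD v hv, ← hfDpar v hv h0] at h1
    have h2 := (hf1 u hu).2
    exact ⟨fun e => h1 (e ▸ h2), fun e => h1 (by rw [e] at h2; simpa using h.A_neg _ h2)⟩
  have hcolrP : ∀ u ∈ P, f' u - f' (p.par u) ≠ f' r - f' (p.par r) ∧
      f' u - f' (p.par u) ≠ -(f' r - f' (p.par r)) := by
    intro u hu
    have h1 := hcolP u hu
    refine ⟨fun e => hrole_r ?_, fun e => hrole_r ?_⟩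
    · rw [e, hcolr] at h1; exact h1
    · rw [e, p.colreg_neg, hcolr] at h1; exact h1
  have hsymm : ∀ {c d : G}, c ≠ d ∧ c ≠ -d → d ≠ c ∧ d ≠ -c := fun {c d} h =>
    ⟨h.1.symm, fun e => h.2 (by rw [e, neg_neg])⟩
  -- counting inner vertices
  have hinner : innerPart p.par p.W (D ∪ C) = innerPart p.par p.W D ∪ P := by
    ext v
    simp only [innerPart, Finset.mem_filter, Finset.mem_union]
    constructor
    · rintro ⟨hv, h1, h2⟩
      rcases (hmem v).1 (Finset.mem_union.2 hv) with hv | rfl | hv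
      · exact Or.inl ⟨hv, h1, h2⟩
      · exact absurd hprW h2
      · exact Or.inr hv
    · rintro (⟨hv, h1, h2⟩ | hv)
      · exact ⟨Or.inl hv, h1, h2⟩
      · exact ⟨Or.inr (hPC v hv), hCW v (hPC v hv), (hP v hv).1⟩
  have hinnerc : (innerPart p.par p.W (D ∪ C)).card = (innerPart p.par p.W D).card + P.card := by
    rw [hinner, Finset.card_union_of_disjoint]
    rw [Finset.disjoint_left]
    intro v hv hvP
    exact (hDP v (Finset.mem_filter.1 hv).1).1 hvP
  refine ⟨f', A \ colours f' p.par P, B \ P.image f', ⟨?_, ?_, ?_, ?_, ?_, ?_, ?_, ?_, ?_, ?_, ?_,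
    ?_, ?_, ?_, ?_, ?_⟩, hfD, hfr⟩
  · exact Finset.union_subset h.sub (Finset.filter_subset _ _)
  · intro v hv h0
    rw [hmem] at hv
    rcases hv with hv | rfl | hv
    · exact Finset.mem_union_left _ (h.par_mem v hv h0)
    · exact Finset.mem_union_left _ hprD
    · exact Finset.mem_union_right _ (hP v hv).2
  · intro v hv hvW
    rcases Finset.mem_union.1 hv with hv | hv
    · exact (h.piece_sub v hv hvW).trans Finset.subset_union_left
    · rw [hCtop v hv]; exact Finset.subset_union_right
  · intro u hu v hv huv
    rw [hmem] at hu hv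
    rcases hu with hu | hu | hu <;> rcases hv with hv | hv | hv
    · rw [hfD u hu, hfD v hv]; exact h.inj u hu v hv huv
    · rw [hv]; exact hinjDr u hu
    · exact hinjDP u hu v hv
    · rw [hu]; exact (hinjDr v hv).symm
    · exact absurd (hu.trans hv.symm) huv
    · rw [hu]; exact hinjrP v hv
    · exact (hinjDP v hv u hu).symm
    · rw [hv]; exact (hinjrP u hu).symm
    · exact (hf2 u hu v hv huv).1
  · intro u hu v hv hu0 hv0 huv
    rw [hmem] at hu hv
    rcases hu with hu | hu | hu <;> rcases hv with hv | hv | hv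
    · rw [hfD u hu, hfD v hv, hfDpar u hu hu0, hfDpar v hv hv0]
      exact h.col u hu v hv hu0 hv0 huv
    · rw [hv]; exact hcolDr u hu hu0
    · exact hcolDP u hu hu0 v hv
    · rw [hu]; exact hsymm (hcolDr v hv hv0)
    · exact absurd (hu.trans hv.symm) huv
    · rw [hu]; exact hcolrP v hv
    · exact hsymm (hcolDP v hv hv0 u hu)
    · rw [hv]; exact hsymm (hcolrP u hu)
    · exact (hf2 u hu v hv huv).2
  · intro v hv
    rw [hmem] at hv
    rcases hv with hv | hv | hv
    · rw [hposD v hv, hroleD v hv]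
    · rw [hv, hfr, hpos]
    · rw [hposP v hv, hroleP v hv]
  · intro v hv h0
    rw [hmem] at hv
    rcases hv with hv | hv | hv
    · rw [hcolD v hv h0, hroleD v hv]
    · rw [hv, hcolr]
    · rw [hcolP v hv, hroleP v hv]
  · rcases hL' with rfl | rfl
    · exact h.L_sub.trans Finset.subset_union_left
    · exact Finset.insert_subset (Finset.mem_union_right _ hrC)
        (h.L_sub.trans Finset.subset_union_left)
  · exact Finset.sdiff_subset.trans h.A_sub
  · intro c hc
    obtain ⟨h1, h2⟩ := Finset.mem_sdiff.1 hc
    refine Finset.mem_sdiff.2 ⟨h.A_neg c h1, fun h3 => h2 ?_⟩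
    obtain ⟨v, hv, h4⟩ := mem_colours.1 h3
    refine mem_colours.2 ⟨v, hv, ?_⟩
    rcases h4 with h4 | h4
    · right; rw [← h4, neg_neg]
    · left; exact neg_injective h4
  · exact Finset.sdiff_subset.trans h.B_sub
  · intro v hv h0 hvA
    obtain ⟨h1, h2⟩ := Finset.mem_sdiff.1 hvA
    rw [hmem] at hv
    rcases hv with hv | hv | hv
    · rw [hfD v hv, hfDpar v hv h0] at h1
      exact h.A_free v hv h0 h1
    · rw [hv] at h1
      have := p.A_reg _ (h.A_sub h1)
      rw [hcolr] at this
      exact hrole_r this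
    · exact h2 (mem_colours.2 ⟨v, hv, Or.inl rfl⟩)
  · intro v hv hvB
    obtain ⟨h1, h2⟩ := Finset.mem_sdiff.1 hvB
    rw [hmem] at hv
    rcases hv with hv | hv | hv
    · rw [hfD v hv] at h1
      exact h.B_free v hv h1
    · rw [hv] at h1
      have := p.B_reg _ (h.B_sub h1)
      rw [hfr, hpos] at this
      exact hrole_r this
    · exact h2 (Finset.mem_image_of_mem _ hv)
  · have h1 := h.A_card
    have h2 := card_colours_le f' p.par P
    have h3 := Finset.le_card_sdiff (colours f' p.par P) A
    rw [hinnerc]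
    omega
  · have h1 := h.B_card
    have h2 := Finset.card_image_le (s := P) (f := f')
    have h3 := Finset.le_card_sdiff (P.image f') B
    rw [hinnerc]
    omega
  · rw [hinnerc]
    refine hpot.trans ?_
    have hδ := p.δ_pos
    have hK := p.K_pos
    have hm := p.m_nonneg
    push_cast
    exact pot_bound_step (by positivity) (by positivity) (pot_nonneg _ _) (Nat.cast_nonneg _)
      (Nat.cast_nonneg _) hN h.pot_le

theorem role_eq_zero {par : ℕ → ℕ} {W L : Finset ℕ} {v : ℕ} : role par W L v = 0 ↔ v ∈ W := by
  unfold role; split_ifs <;> simp_all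

theorem role_eq_one {par : ℕ → ℕ} {W L : Finset ℕ} {v : ℕ} :
    role par W L v = 1 ↔ v ∉ W ∧ par v ∈ W ∧ v ∉ L := by
  unfold role; split_ifs <;> simp_all

theorem role_eq_two {par : ℕ → ℕ} {W L : Finset ℕ} {v : ℕ} :
    role par W L v = 2 ↔ v ∉ W ∧ par v ∈ W ∧ v ∈ L := by
  unfold role; split_ifs <;> simp_all

/-- The points `y` that would repeat, when joined to `x`, a point or a colour used by `S`. -/
def clashes (f : ℕ → G) (par : ℕ → ℕ) (S : Finset ℕ) (x : G) : Finset G :=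
  S.image f ∪ (S.image (fun u => x + (f u - f (par u))) ∪ S.image (fun u => x - (f u - f (par u))))

theorem card_clashes_le (f : ℕ → G) (par : ℕ → ℕ) (S : Finset ℕ) (x : G) :
    (clashes f par S x).card ≤ 3 * S.card := by
  have h : (clashes f par S x).card ≤ S.card + (S.card + S.card) :=
    (Finset.card_union_le _ _).trans (add_le_add Finset.card_image_le
      ((Finset.card_union_le _ _).trans
        (add_le_add Finset.card_image_le Finset.card_image_le)))
  omega

theorem notMem_clashes {f : ℕ → G} {par : ℕ → ℕ} {S : Finset ℕ} {x y : G}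
    (h : y ∉ clashes f par S x) {v : ℕ} (hv : v ∈ S) :
    f v ≠ y ∧ y - x ≠ f v - f (par v) ∧ y - x ≠ -(f v - f (par v)) := by
  simp only [clashes, Finset.mem_union, Finset.mem_image, not_or, not_exists, not_and] at h
  refine ⟨h.1 v hv, fun e => h.2.1 v hv ?_, fun e => h.2.2 v hv ?_⟩
  · rw [← e]; abel
  · rw [sub_eq_add_neg x, ← e]; abel

theorem State.exists_add_hub (h : p.State D L f A B) {w : ℕ} (hw : w ∈ p.W) (hwD : w ∉ D)
    (hpw : w = 0 ∨ p.par w ∈ D) :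
    ∃ f', p.State (insert w D) L f' A B ∧ ∀ v ∈ D, f' v = f v := by
  classical
  set x := f (p.par w) with hx
  obtain ⟨y, hy, hyc⟩ : ∃ y ∈ Finset.univ.filter fun y => p.posreg y = 0 ∧ p.colreg (y - x) = 0,
      y ∉ clashes f p.par (p.W ∩ D) x := by
    refine Finset.exists_mem_notMem_of_card_lt_card (lt_of_le_of_lt ?_ (p.exists_hub x))
    refine (card_clashes_le _ _ _ _).trans ?_
    have := Finset.card_le_card (Finset.inter_subset_left (s₁ := p.W) (s₂ := D))
    omega
  obtain ⟨hy1, hy2⟩ := (Finset.mem_filter.1 hy).2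
  have hne : ∀ v ∈ D, v ≠ w := fun v hv e => hwD (e ▸ hv)
  have hDpar : ∀ v ∈ D, v ≠ 0 → p.par v ≠ w := fun v hv h0 => hne _ (h.par_mem v hv h0)
  set f' := Function.update f w y with hf'
  have hfD : ∀ v ∈ D, f' v = f v := fun v hv => Function.update_of_ne (hne v hv) _ _
  have hfDp : ∀ v ∈ D, v ≠ 0 → f' (p.par v) = f (p.par v) := fun v hv h0 =>
    Function.update_of_ne (hDpar v hv h0) _ _
  have hfw : f' w = y := Function.update_self _ _ _
  have hfpw : w ≠ 0 → f' (p.par w) = x := fun h0 =>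
    Function.update_of_ne (p.par_lt w h0).ne _ _
  have hrole : role p.par p.W L w = 0 := role_eq_zero.2 hw
  have hinj : ∀ v ∈ D, f' v ≠ f' w := by
    intro v hv e
    rw [hfD v hv, hfw] at e
    have h1 := h.pos_role v hv
    rw [e, hy1] at h1
    exact (notMem_clashes hyc (Finset.mem_inter.2 ⟨role_eq_zero.1 h1.symm, hv⟩)).1 e
  have hcol : ∀ v ∈ D, v ≠ 0 → w ≠ 0 → f' w - f' (p.par w) ≠ f' v - f' (p.par v) ∧
      f' w - f' (p.par w) ≠ -(f' v - f' (p.par v)) := by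
    intro v hv h0 hw0
    rw [hfw, hfpw hw0, hfD v hv, hfDp v hv h0]
    have h1 := h.col_role v hv h0
    refine ⟨fun e => ?_, fun e => ?_⟩
    · rw [← e, hy2] at h1
      exact (notMem_clashes hyc (Finset.mem_inter.2 ⟨role_eq_zero.1 h1.symm, hv⟩)).2.1 e
    · rw [← p.colreg_neg, ← e, hy2] at h1
      exact (notMem_clashes hyc (Finset.mem_inter.2 ⟨role_eq_zero.1 h1.symm, hv⟩)).2.2 e
  have hinner : innerPart p.par p.W (insert w D) = innerPart p.par p.W D := by
    unfold innerPart; rw [Finset.filter_insert]; simp [hw]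
  refine ⟨f', ⟨?_, ?_, ?_, ?_, ?_, ?_, ?_, ?_, h.A_sub, h.A_neg, h.B_sub, ?_, ?_, ?_, ?_, ?_⟩, hfD⟩
  · exact Finset.insert_subset (p.W_sub hw) h.sub
  · intro v hv h0
    rcases Finset.mem_insert.1 hv with rfl | hv
    · exact Finset.mem_insert_of_mem (hpw.resolve_left h0)
    · exact Finset.mem_insert_of_mem (h.par_mem v hv h0)
  · intro v hv hvW
    rcases Finset.mem_insert.1 hv with rfl | hv
    · exact absurd hw hvW
    · exact (h.piece_sub v hv hvW).trans (Finset.subset_insert _ _)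
  · intro u hu v hv huv
    rcases Finset.mem_insert.1 hu with hu | hu <;> rcases Finset.mem_insert.1 hv with hv | hv
    · exact absurd (hu.trans hv.symm) huv
    · rw [hu]; exact (hinj v hv).symm
    · rw [hv]; exact hinj u hu
    · rw [hfD u hu, hfD v hv]; exact h.inj u hu v hv huv
  · intro u hu v hv hu0 hv0 huv
    rcases Finset.mem_insert.1 hu with hu | hu <;> rcases Finset.mem_insert.1 hv with hv | hv
    · exact absurd (hu.trans hv.symm) huv
    · have := hcol v hv hv0 (hu ▸ hu0)
      rw [hu]
      exact ⟨this.1.symm, fun e => this.2 (by rw [e, neg_neg])⟩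
    · have := hcol u hu hu0 (hv ▸ hv0)
      rw [hv]; exact this
    · rw [hfD u hu, hfD v hv, hfDp u hu hu0, hfDp v hv hv0]; exact h.col u hu v hv hu0 hv0 huv
  · intro v hv
    rcases Finset.mem_insert.1 hv with rfl | hv
    · rw [hfw, hy1, hrole]
    · rw [hfD v hv]; exact h.pos_role v hv
  · intro v hv h0
    rcases Finset.mem_insert.1 hv with rfl | hv
    · rw [hfw, hfpw h0, hy2, hrole]
    · rw [hfD v hv, hfDp v hv h0]; exact h.col_role v hv h0
  · exact h.L_sub.trans (Finset.subset_insert _ _)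
  · intro v hv h0
    rcases Finset.mem_insert.1 hv with rfl | hv
    · rw [hfw, hfpw h0]
      intro hA
      have := p.A_reg _ (h.A_sub hA)
      omega
    · rw [hfD v hv, hfDp v hv h0]; exact h.A_free v hv h0
  · intro v hv
    rcases Finset.mem_insert.1 hv with rfl | hv
    · rw [hfw]
      intro hB
      have := p.B_reg _ (h.B_sub hB)
      omega
    · rw [hfD v hv]; exact h.B_free v hv
  · rw [hinner]; exact h.A_card
  · rw [hinner]; exact h.B_card
  · rw [hinner]; exact h.pot_le

theorem State.exists_add_link (h : p.State D L f A B) {r : ℕ}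
    (hr : r ∈ Finset.range (p.n + 1)) (hrW : r ∉ p.W) (hprW : p.par r ∈ p.W) (hrD : r ∉ D)
    (hprD : p.par r ∈ D) (hL : (L.card : ℝ) ≤ p.W.card + p.β) :
    ∃ f' A' B', p.State (D ∪ piece p.n p.par p.W r) (insert r L) f' A' B' ∧
      ∀ v ∈ D, f' v = f v := by
  classical
  set x := f (p.par r) with hx
  have hx0 : p.posreg x = 0 := by rw [h.pos_role _ hprD, role_eq_zero]; exact hprW
  have hrole : role p.par p.W (insert r L) r = 2 :=
    role_eq_two.2 ⟨hrW, hprW, Finset.mem_insert_self _ _⟩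
  obtain ⟨y, hy, hyc⟩ : ∃ y ∈ Finset.univ.filter fun y => p.posreg y = 2 ∧ p.colreg (y - x) = 2,
      y ∉ clashes f p.par L x ∪ p.bad A B := by
    refine Finset.exists_mem_notMem_of_card_lt_card ?_
    have h1 : (clashes f p.par L x ∪ p.bad A B).card ≤ 3 * L.card + (p.bad A B).card :=
      (Finset.card_union_le _ _).trans (Nat.add_le_add_right (card_clashes_le _ _ _ _) _)
    have h2 : ((clashes f p.par L x ∪ p.bad A B).card : ℝ) ≤
        3 * L.card + (p.bad A B).card := by exact_mod_cast h1
    have h3 := p.exists_link x hx0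
    have h4 := h.card_bad_le
    have : ((clashes f p.par L x ∪ p.bad A B).card : ℝ) <
        (Finset.univ.filter fun y => p.posreg y = 2 ∧ p.colreg (y - x) = 2).card := by linarith
    exact_mod_cast this
  obtain ⟨hy1, hy2⟩ := (Finset.mem_filter.1 hy).2
  rw [Finset.mem_union, not_or] at hyc
  obtain ⟨f', A', B', h', hf', -⟩ := h.exists_add_piece hr hrW hprW hrD hprD (Or.inr rfl) hyc.2
    (by rw [hy1, hrole]) (by rw [← hx, hy2, hrole]) (fun v _ hv2 => by
      rw [hrole, role_eq_two] at hv2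
      have := notMem_clashes hyc.1 hv2.2.2
      exact ⟨this.1, fun _ => this.2⟩)
  exact ⟨f', A', B', h', hf'⟩

theorem exists_hub_state (p : Plan G) (t : ℕ) :
    ∃ D L f A B, p.State D L f A B ∧ (∀ w ∈ p.W, w ∈ D ↔ w < t) ∧
      (∀ v ∈ D, v ∉ p.W → p.par v ∈ p.W → v ∈ L) ∧
      L.card ≤ (p.W.filter fun w => w < t).card := by
  classical
  have hβ : 0 ≤ p.β := by
    refine le_trans ?_ p.β_large
    have := p.K_pos
    have h1 : 0 ≤ p.Φ := by
      refine le_trans ?_ p.pot_small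
      have := p.m_nonneg
      have := p.δ_pos
      have := pot_nonneg p.A₀ p.B₀
      positivity
    positivity
  induction t with
  | zero =>
    refine ⟨∅, ∅, fun _ => 0, p.A₀, p.B₀, ⟨?_, ?_, ?_, ?_, ?_, ?_, ?_, ?_, ?_, p.A_neg, ?_, ?_, ?_,
      ?_, ?_, ?_⟩, ?_, ?_, ?_⟩
    all_goals simp [innerPart]
  | succ t ih =>
    obtain ⟨D, L, f, A, B, h, hW, hR, hL⟩ := ih
    by_cases ht : t ∈ p.W
    swap
    · refine ⟨D, L, f, A, B, h, fun w hw => ?_, hR, hL.trans (Finset.card_le_card ?_)⟩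
      · rw [hW w hw]
        have : w ≠ t := fun e => ht (e ▸ hw)
        omega
      · intro w hw
        obtain ⟨h1, h2⟩ := Finset.mem_filter.1 hw
        exact Finset.mem_filter.2 ⟨h1, by omega⟩
    have htD : t ∉ D := fun h => lt_irrefl t ((hW t ht).1 h)
    have hfil : (p.W.filter fun w => w < t + 1).card = (p.W.filter fun w => w < t).card + 1 := by
      have : (p.W.filter fun w => w < t + 1) = insert t (p.W.filter fun w => w < t) := by
        ext w
        simp only [Finset.mem_filter, Finset.mem_insert]
        constructor
        · rintro ⟨h1, h2⟩
          rcases (Nat.lt_succ_iff.1 h2).eq_or_lt with h3 | h3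
          · exact Or.inl h3
          · exact Or.inr ⟨h1, h3⟩
        · rintro (rfl | ⟨h1, h2⟩)
          · exact ⟨ht, by omega⟩
          · exact ⟨h1, by omega⟩
      rw [this, Finset.card_insert_of_notMem (by simp)]
    -- it suffices to reach a state that contains the parent of `t`
    obtain ⟨D', L', f', A', B', h', hW', hR', hL', hpt⟩ : ∃ D L f A B, p.State D L f A B ∧
        (∀ w ∈ p.W, w ∈ D ↔ w < t) ∧ (∀ v ∈ D, v ∉ p.W → p.par v ∈ p.W → v ∈ L) ∧
        L.card ≤ (p.W.filter fun w => w < t + 1).card ∧ (t = 0 ∨ p.par t ∈ D) := by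
      rcases Nat.eq_zero_or_pos t with h0 | h0
      · exact ⟨D, L, f, A, B, h, hW, hR, by omega, Or.inl h0⟩
      have hlt := p.par_lt t (by omega)
      by_cases hptW : p.par t ∈ p.W
      · exact ⟨D, L, f, A, B, h, hW, hR, by omega, Or.inr ((hW _ hptW).2 hlt)⟩
      obtain ⟨hr1, hr2, hr3⟩ := topOf_spec p.zero_mem p.par_lt _ hptW
      set r := topOf p.par p.W (p.par t) with hr
      have htn := Finset.mem_range.1 (p.W_sub ht)
      have hmem : p.par t ∈ piece p.n p.par p.W r :=
        Finset.mem_filter.2 ⟨Finset.mem_range.2 (by omega), hptW, hr.symm⟩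
      by_cases hrD : r ∈ D
      · have h1 := h.piece_sub r hrD hr1
        rw [topOf_of_mem hr2] at h1
        exact ⟨D, L, f, A, B, h, hW, hR, by omega, Or.inr (h1 hmem)⟩
      have hr0 : r ≠ 0 := fun e => hr1 (e ▸ p.zero_mem)
      have hprD : p.par r ∈ D := (hW _ hr2).2 (by have := p.par_lt r hr0; omega)
      have hLW : (L.card : ℝ) ≤ p.W.card + p.β := by
        have h1 := hL.trans (Finset.card_filter_le _ _)
        have h2 : (L.card : ℝ) ≤ p.W.card := by exact_mod_cast h1
        linarith
      obtain ⟨f', A', B', h', -⟩ := h.exists_add_link (Finset.mem_range.2 (by omega)) hr1 hr2 hrD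
        hprD hLW
      refine ⟨_, _, f', A', B', h', fun w hw => ?_, fun v hv hvW hpv => ?_, ?_,
        Or.inr (Finset.mem_union_right _ hmem)⟩
      · rw [Finset.mem_union, ← hW w hw]
        exact or_iff_left fun h => (Finset.mem_filter.1 h).2.1 hw
      · rcases Finset.mem_union.1 hv with hv | hv
        · exact Finset.mem_insert_of_mem (hR v hv hvW hpv)
        · have := (Finset.mem_filter.1 hv).2.2
          rw [topOf_of_mem hpv] at this
          exact this ▸ Finset.mem_insert_self _ _
      · have := Finset.card_insert_le r L
        omega
    have htD' : t ∉ D' := fun h => lt_irrefl t ((hW' t ht).1 h)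
    obtain ⟨f'', h'', -⟩ := h'.exists_add_hub ht htD' hpt
    refine ⟨_, _, f'', A', B', h'', fun w hw => ?_, fun v hv hvW hpv => ?_, hL'⟩
    · rw [Finset.mem_insert, hW' w hw]; omega
    · rcases Finset.mem_insert.1 hv with rfl | hv
      · exact absurd ht hvW
      · exact hR' v hv hvW hpv

/-- The top vertices of the pieces which have not been embedded yet. -/
def rest (p : Plan G) (D : Finset ℕ) : Finset ℕ :=
  (Finset.range (p.n + 1)).filter fun r => r ∉ p.W ∧ p.par r ∈ p.W ∧ r ∉ D

theorem card_rest_union (p : Plan G) {D : Finset ℕ} {r : ℕ} (hr : r ∈ p.rest D) :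
    (p.rest (D ∪ piece p.n p.par p.W r)).card + 1 ≤ (p.rest D).card := by
  refine Finset.card_lt_card ((Finset.ssubset_iff_of_subset ?_).2 ⟨r, hr, fun h => ?_⟩)
  · intro u hu
    obtain ⟨h1, h2, h3, h4⟩ := Finset.mem_filter.1 hu
    exact Finset.mem_filter.2 ⟨h1, h2, h3, fun h => h4 (Finset.mem_union_left _ h)⟩
  · obtain ⟨h1, h2, h3, -⟩ := Finset.mem_filter.1 hr
    exact (Finset.mem_filter.1 h).2.2.2
      (Finset.mem_union_right _ (Finset.mem_filter.2 ⟨h1, h2, topOf_of_mem h3⟩))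

theorem State.exists_star_state (h : p.State D L f A B) (hW : p.W ⊆ D)
    {σ : ℕ → G} (hσ : ∀ r ∈ Finset.range (p.n + 1), r ∉ p.W → p.par r ∈ p.W →
      p.posreg (σ r) = 1 ∧ p.colreg (σ r - f (p.par r)) = 1 ∧
      ∀ u ∈ Finset.range (p.n + 1), u ∉ p.W → p.par u ∈ p.W → u ≠ r → σ u ≠ σ r ∧
        σ r - f (p.par r) ≠ σ u - f (p.par u) ∧ σ r - f (p.par r) ≠ -(σ u - f (p.par u)))
    (hfσ : ∀ v ∈ D, v ∉ p.W → p.par v ∈ p.W → v ∉ L → f v = σ v) :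
    ∃ D' f' A' B', p.State D' L f' A' B' ∧ p.W ⊆ D' ∧ ((p.rest D').card : ℝ) ≤ p.β := by
  classical
  induction hk : (p.rest D).card using Nat.strong_induction_on generalizing D f A B with
  | _ k ih =>
    subst hk
    by_cases hβ : ((p.rest D).card : ℝ) ≤ p.β
    · exact ⟨D, f, A, B, h, hW, hβ⟩
    obtain ⟨r, hr, hrbad⟩ : ∃ r ∈ p.rest D, σ r ∉ p.bad A B := by
      by_contra! hcon
      have hinj : Set.InjOn σ (p.rest D) := by
        intro u hu v hv huv
        obtain ⟨h1, h2, h3, -⟩ := Finset.mem_filter.1 hu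
        obtain ⟨h4, h5, h6, -⟩ := Finset.mem_filter.1 hv
        by_contra hne
        exact ((hσ v h4 h5 h6).2.2 u h1 h2 h3 hne).1 huv
      have h1 := Finset.card_le_card_of_injOn σ hcon hinj
      have h2 : ((p.rest D).card : ℝ) ≤ (p.bad A B).card := by exact_mod_cast h1
      exact hβ (h2.trans h.card_bad_le)
    obtain ⟨hr1, hr2, hr3, hr4⟩ := Finset.mem_filter.1 hr
    obtain ⟨hs1, hs2, hs3⟩ := hσ r hr1 hr2 hr3
    have hrole : role p.par p.W L r = 1 := role_eq_one.2 ⟨hr2, hr3, fun hL => hr4 (h.L_sub hL)⟩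
    obtain ⟨f', A', B', h', hf', hf'r⟩ := h.exists_add_piece hr1 hr2 hr3 hr4 (hW hr3) (Or.inl rfl)
      hrbad (by rw [hs1, hrole]) (by rw [hs2, hrole]) (fun v hv hv1 => by
        rw [hrole, role_eq_one] at hv1
        obtain ⟨h1, h2, h3⟩ := hv1
        obtain ⟨e1, e2⟩ := hs3 v (h.sub hv) h1 h2 (fun e => hr4 (e ▸ hv))
        rw [hfσ v hv h1 h2 h3]
        exact ⟨e1, fun _ => e2⟩)
    have hcard := p.card_rest_union hr
    refine ih _ (by omega) h' (hW.trans Finset.subset_union_left) ?_ ?_ rfl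
    · intro u hu huW hpu
      obtain ⟨h1, h2, h3⟩ := hσ u hu huW hpu
      rw [hf' _ (hW hpu)]
      refine ⟨h1, h2, fun v hv hvW hpv hne => ?_⟩
      rw [hf' _ (hW hpv)]
      exact h3 v hv hvW hpv hne
    · intro v hv hvW hpv hvL
      rcases Finset.mem_union.1 hv with hv | hv
      · rw [hf' v hv]; exact hfσ v hv hvW hpv hvL
      · have := (Finset.mem_filter.1 hv).2.2
        rw [topOf_of_mem hpv] at this
        rw [this, hf'r]

theorem State.exists_full_state (h : p.State D L f A B) (hW : p.W ⊆ D)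
    (hL : (L.card : ℝ) + (p.rest D).card ≤ p.W.card + p.β) :
    ∃ L' f' A' B', p.State (Finset.range (p.n + 1)) L' f' A' B' := by
  classical
  induction hk : (p.rest D).card using Nat.strong_induction_on generalizing D L f A B with
  | _ k ih =>
    subst hk
    rcases (p.rest D).eq_empty_or_nonempty with he | ⟨r, hr⟩
    · have : D = Finset.range (p.n + 1) := by
        refine h.sub.antisymm fun v hv => ?_
        by_cases hvW : v ∈ p.W
        · exact hW hvW
        obtain ⟨h1, h2, h3⟩ := topOf_spec p.zero_mem p.par_lt v hvW
        have hmem : topOf p.par p.W v ∈ D := by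
          by_contra hcon
          have : topOf p.par p.W v ∈ p.rest D := Finset.mem_filter.2
            ⟨Finset.mem_range.2 (by have := Finset.mem_range.1 hv; omega), h1, h2, hcon⟩
          rw [he] at this
          simp at this
        have := h.piece_sub _ hmem h1
        rw [topOf_of_mem h2] at this
        exact this (Finset.mem_filter.2 ⟨hv, hvW, rfl⟩)
      exact ⟨L, f, A, B, this ▸ h⟩
    · obtain ⟨hr1, hr2, hr3, hr4⟩ := Finset.mem_filter.1 hr
      obtain ⟨f', A', B', h', -⟩ := h.exists_add_link hr1 hr2 hr3 hr4 (hW hr3)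
        (by linarith [(Nat.cast_nonneg (p.rest D).card : (0 : ℝ) ≤ _)])
      have hcard := p.card_rest_union hr
      refine ih _ (by omega) h' (hW.trans Finset.subset_union_left) ?_ rfl
      have h1 := Finset.card_insert_le r L
      have h2 : ((insert r L).card : ℝ) ≤ L.card + 1 := by exact_mod_cast h1
      have h3 : ((p.rest (D ∪ piece p.n p.par p.W r)).card : ℝ) + 1 ≤ (p.rest D).card := by
        exact_mod_cast hcard
      linarith

theorem exists_embedding (p : Plan G) :
    ∃ f : ℕ → G, (∀ u ≤ p.n, ∀ v ≤ p.n, u ≠ v → f u ≠ f v) ∧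
      ∀ u ≤ p.n, ∀ v ≤ p.n, u ≠ 0 → v ≠ 0 → u ≠ v →
        f v - f (p.par v) ≠ f u - f (p.par u) ∧ f v - f (p.par v) ≠ -(f u - f (p.par u)) := by
  obtain ⟨D, L, f, A, B, h, hW, hR, hL⟩ := p.exists_hub_state (p.n + 1)
  have hWD : p.W ⊆ D := fun w hw => (hW w hw).2 (Finset.mem_range.1 (p.W_sub hw))
  obtain ⟨σ, hσ⟩ := p.exists_star f
    (fun w hw => by rw [h.pos_role w (hWD hw)]; exact role_eq_zero.2 hw)
    (fun u hu v hv huv => h.inj u (hWD hu) v (hWD hv) huv)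
  obtain ⟨D', f', A', B', h', hW', hrest⟩ := h.exists_star_state hWD hσ
    (fun v hv hvW hpv hvL => absurd (hR v hv hvW hpv) hvL)
  have hL' : (L.card : ℝ) ≤ p.W.card := by exact_mod_cast hL.trans (Finset.card_filter_le _ _)
  obtain ⟨L'', f'', A'', B'', h''⟩ := h'.exists_full_state hW' (by linarith)
  refine ⟨f'', fun u hu v hv huv => h''.inj u ?_ v ?_ huv,
    fun u hu v hv hu0 hv0 huv => h''.col u ?_ v ?_ hu0 hv0 huv⟩ <;>
  · rw [Finset.mem_range]; omega

end Plan

end Global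

section Selection

variable {G : Type*} [AddCommGroup G] [Fintype G] [DecidableEq G]

theorem abs_sum_drift_le (S T : Finset G) : |∑ x ∈ S, drift T x| ≤ pot S T := by
  have hS := energy_nonneg S
  have hT := energy_nonneg T
  rw [← sum_bal_mul_drift', drift, ← sum_corr_mul]
  refine (sum_mul_le_sqrt _ _ _).trans ?_
  have h1 : √(∑ i, corr (bal T) (bal T) i ^ 2) ≤ √(pot S T) :=
    Real.sqrt_le_sqrt (by unfold pot; change energy T ≤ _; linarith)
  have h2 : √(∑ i, corr (bal S) (bal T) i ^ 2) ≤ √(pot S T) := by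
    refine Real.sqrt_le_sqrt ((sum_corr_bal_sq_le S T).trans ?_)
    unfold pot
    nlinarith [Real.sq_sqrt hS, Real.sq_sqrt hT, sq_nonneg (√(energy S) - √(energy T))]
  calc _ ≤ √(pot S T) * √(pot S T) := mul_le_mul h1 h2 (Real.sqrt_nonneg _) (Real.sqrt_nonneg _)
    _ = _ := Real.mul_self_sqrt (pot_nonneg S T)

theorem exists_small_pot_step (hodd : ∀ x : G, x = -x → x = 0) {S T : Finset G} (hST : S ⊆ T)
    (hS : ∀ x ∈ S, -x ∈ S) (hS0 : (0 : G) ∉ S) {s : ℝ} (hs : 0 < s) (hsS : s ≤ S.card) :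
    ∃ x ∈ S, pot (S \ {x, -x}) (T \ {x}) ≤
      pot S T + (4 * pot S T / s + 220 * Fintype.card G) := by
  have hN := card_pos_real (G := G)
  have hP := pot_nonneg S T
  have hE := energy_nonneg S
  have hne : S.Nonempty := by
    rw [← Finset.card_pos]; exact_mod_cast hs.trans_le hsS
  have h1 : ∑ x ∈ S, -(4 * pot S T / s) ≤ ∑ x ∈ S, (8 * drift S x + 4 * drift T x) := by
    rw [Finset.sum_add_distrib, ← Finset.mul_sum, ← Finset.mul_sum, sum_mem_drift,
      Finset.sum_const, nsmul_eq_mul]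
    have h2 := (abs_le.1 (abs_sum_drift_le S T)).1
    have h3 : pot S T ≤ S.card * (pot S T / s) := by
      rw [mul_div_assoc', le_div_iff₀ hs, mul_comm]
      exact mul_le_mul_of_nonneg_right hsS hP
    have h4 : (S.card : ℝ) * -(4 * pot S T / s) = -4 * (S.card * (pot S T / s)) := by ring
    rw [h4]; linarith
  obtain ⟨x, hx, hle⟩ := Finset.exists_le_of_sum_le hne h1
  refine ⟨x, hx, ?_⟩
  have hxne : x ≠ -x := fun h => hS0 (hodd x h ▸ hx)
  have e1 := energy_sdiff_le (Q := {x, -x}) (S := S) (by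
    intro y hy
    simp only [Finset.mem_insert, Finset.mem_singleton] at hy
    rcases hy with rfl | rfl
    · exact hx
    · exact hS x hx)
  have e2 := energy_sdiff_le (Q := {x}) (S := T) (by simpa using hST hx)
  rw [Finset.sum_pair hxne, drift_neg hS, Finset.card_pair hxne] at e1
  rw [Finset.sum_singleton, Finset.card_singleton] at e2
  push_cast at e1 e2
  change energy _ + energy _ ≤ energy S + energy T + _
  linarith

theorem exists_small_pot (hodd : ∀ x : G, x = -x → x = 0) {α : ℝ} (hα : 0 < α) (j : ℕ)
    (hj : α * Fintype.card G + 2 * j + 1 ≤ Fintype.card G) :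
    ∃ J : Finset G, J.card = j ∧ 0 ∉ J ∧ (∀ x ∈ J, -x ∉ J) ∧
      pot (Finset.univ.filter fun x => x ≠ 0 ∧ x ∉ J ∧ -x ∉ J)
        (Finset.univ.filter fun x => x ≠ 0 ∧ x ∉ J) ≤
      Real.exp (4 / α * j / Fintype.card G) *
        (88 * Fintype.card G + 220 * Fintype.card G * j) := by
  have hN := card_pos_real (G := G)
  induction j with
  | zero =>
    refine ⟨∅, rfl, by simp, by simp, ?_⟩
    have h : (Finset.univ.filter fun x : G => x ≠ 0) = Finset.univ \ {0} := by
      ext; simp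
    have e := energy_sdiff_le (G := G) (Q := {0}) (S := Finset.univ) (by simp)
    rw [Finset.sum_singleton, drift_univ, energy_univ, Finset.card_singleton] at e
    simp only [Finset.notMem_empty, not_false_eq_true, and_true, h, pot]
    simp only [Nat.cast_zero, mul_zero, zero_div, Real.exp_zero, Nat.cast_one] at e ⊢
    linarith
  | succ j ih =>
    push_cast at hj
    obtain ⟨J, hJc, hJ0, hJn, hJ⟩ := ih (by linarith)
    set S := Finset.univ.filter fun x : G => x ≠ 0 ∧ x ∉ J ∧ -x ∉ J with hS
    set T := Finset.univ.filter fun x : G => x ≠ 0 ∧ x ∉ J with hT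
    have hmS : ∀ x, x ∈ S ↔ x ≠ 0 ∧ x ∉ J ∧ -x ∉ J := by intro x; simp [hS]
    have hmT : ∀ x, x ∈ T ↔ x ≠ 0 ∧ x ∉ J := by intro x; simp [hT]
    have hSc : α * Fintype.card G ≤ S.card := by
      have hc : (Finset.univ : Finset G) ⊆ S ∪ ({0} ∪ (J ∪ J.image fun x => -x)) := by
        intro x _
        simp only [Finset.mem_union, hmS, Finset.mem_singleton, Finset.mem_image]
        by_cases h0 : x = 0
        · exact Or.inr (Or.inl h0)
        by_cases h1 : x ∈ J
        · exact Or.inr (Or.inr (Or.inl h1))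
        by_cases h2 : -x ∈ J
        · exact Or.inr (Or.inr (Or.inr ⟨-x, h2, neg_neg x⟩))
        · exact Or.inl ⟨h0, h1, h2⟩
      have h1 := Finset.card_le_card hc
      have h2 := Finset.card_union_le S ({0} ∪ (J ∪ J.image fun x => -x))
      have h3 := Finset.card_union_le ({0} : Finset G) (J ∪ J.image fun x => -x)
      have h4 := Finset.card_union_le J (J.image fun x => -x)
      have h5 := Finset.card_image_le (s := J) (f := fun x => -x)
      rw [Finset.card_singleton] at h3
      rw [Finset.card_univ] at h1
      have h6 : Fintype.card G ≤ S.card + 1 + 2 * j := by omega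
      have h7 : (Fintype.card G : ℝ) ≤ S.card + 1 + 2 * j := by exact_mod_cast h6
      linarith
    obtain ⟨x, hx, hle⟩ := exists_small_pot_step hodd (S := S) (T := T)
      (fun y hy => (hmT y).2 ⟨((hmS y).1 hy).1, ((hmS y).1 hy).2.1⟩)
      (fun y hy => by
        obtain ⟨h1, h2, h3⟩ := (hmS y).1 hy
        exact (hmS _).2 ⟨neg_ne_zero.2 h1, h3, by rwa [neg_neg]⟩)
      (fun h => ((hmS 0).1 h).1 rfl) (by positivity : 0 < α * Fintype.card G) hSc
    obtain ⟨hx0, hxJ, hxJ'⟩ := (hmS x).1 hx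
    have hxne : x ≠ -x := fun h => hx0 (hodd x h)
    refine ⟨insert x J, ?_, ?_, ?_, ?_⟩
    · rw [Finset.card_insert_of_notMem hxJ, hJc]
    · simp [hJ0, hx0.symm]
    · intro y hy hy'
      rcases Finset.mem_insert.1 hy with rfl | hy
      · rcases Finset.mem_insert.1 hy' with e | h
        · exact hxne e.symm
        · exact hxJ' h
      · rcases Finset.mem_insert.1 hy' with e | h
        · exact hxJ' (by rw [← e, neg_neg]; exact hy)
        · exact hJn y hy h
    · have e1 : (Finset.univ.filter fun y : G => y ≠ 0 ∧ y ∉ insert x J ∧ -y ∉ insert x J) =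
          S \ {x, -x} := by
        ext y
        simp only [Finset.mem_filter, Finset.mem_univ, true_and, Finset.mem_sdiff, hmS,
          Finset.mem_insert, Finset.mem_singleton, not_or, neg_eq_iff_eq_neg]
        tauto
      have e2 : (Finset.univ.filter fun y : G => y ≠ 0 ∧ y ∉ insert x J) = T \ {x} := by
        ext y
        simp only [Finset.mem_filter, Finset.mem_univ, true_and, Finset.mem_sdiff, hmT,
          Finset.mem_insert, Finset.mem_singleton, not_or]
        tauto
      rw [e1, e2]
      refine hle.trans ?_
      have := pot_bound_step (c := 4 / α) (e := 220 * Fintype.card G) (q := 1) (by positivity)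
        (by positivity) (pot_nonneg S T) (Nat.cast_nonneg j) zero_le_one hN hJ
      push_cast
      refine le_trans (le_of_eq ?_) this
      field_simp

theorem sum_corr_indic_sq (S : Finset G) :
    ∑ d, corr (indic S) (indic S) d ^ 2 = energy S + (S.card : ℝ) ^ 4 / Fintype.card G := by
  have hN := card_pos_real (G := G)
  have h0 : ∑ d, corr (bal S) (bal S) d = 0 := by rw [sum_corr, sum_bal, mul_zero]
  have h1 : ∀ d, corr (indic S) (indic S) d ^ 2 = corr (bal S) (bal S) d ^ 2 +
      2 * ((S.card : ℝ) * S.card / Fintype.card G) * corr (bal S) (bal S) d +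
      ((S.card : ℝ) * S.card / Fintype.card G) ^ 2 := by
    intro d; rw [corr_indic_indic]; ring
  simp only [h1, Finset.sum_add_distrib, ← Finset.mul_sum, h0, Finset.sum_const,
    Finset.card_univ, nsmul_eq_mul, mul_zero, add_zero]
  unfold energy
  field_simp

theorem sum_corr_indic_sq_le (S : Finset G) :
    ∑ d, corr (indic S) (indic S) d ^ 2 ≤ (Fintype.card G : ℝ) ^ 3 := by
  have h1 : ∀ d ∈ (Finset.univ : Finset G),
      corr (indic S) (indic S) d ^ 2 ≤ (Fintype.card G : ℝ) ^ 2 := by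
    intro d _
    rw [← card_filter_eq_corr]
    have : (S.filter fun y => y - d ∈ S).card ≤ Fintype.card G := Finset.card_le_univ _
    gcongr
  have := Finset.sum_le_sum h1
  rw [Finset.sum_const, Finset.card_univ, nsmul_eq_mul] at this
  linarith

variable {H : Type*} [AddCommGroup H] [Fintype H] [DecidableEq H]

theorem corr_indic_product (S : Finset G) (T : Finset H) (d : G × H) :
    corr (indic (S ×ˢ T)) (indic (S ×ˢ T)) d =
      corr (indic S) (indic S) d.1 * corr (indic T) (indic T) d.2 := by
  unfold corr
  rw [Fintype.sum_prod_type, Finset.sum_mul_sum]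
  refine Finset.sum_congr rfl fun x _ => Finset.sum_congr rfl fun y _ => ?_
  have : ∀ a : G, ∀ b : H, indic (S ×ˢ T) (a, b) = indic S a * indic T b := by
    intro a b
    unfold indic
    by_cases h1 : a ∈ S <;> by_cases h2 : b ∈ T <;> simp [h1, h2]
  rw [show (x, y) + d = (x + d.1, y + d.2) from rfl, this, this]
  ring

theorem energy_product_le (E : Finset G) (T : Finset H) :
    energy ((Finset.univ \ E) ×ˢ T) ≤ (Fintype.card G : ℝ) ^ 3 * energy T +
      4 * E.card * (Fintype.card G : ℝ) ^ 2 * (Fintype.card H : ℝ) ^ 3 := by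
  have hN := card_pos_real (G := G)
  have hM := card_pos_real (G := H)
  have h1 := sum_corr_indic_sq ((Finset.univ \ E) ×ˢ T)
  simp only [corr_indic_product, mul_pow] at h1
  rw [Fintype.sum_prod_type] at h1
  dsimp only at h1
  rw [← Finset.sum_mul_sum, sum_corr_indic_sq T] at h1
  have h2 := sum_corr_indic_sq_le (Finset.univ \ E : Finset G)
  have h3 : (((Finset.univ \ E : Finset G)).card : ℝ) = Fintype.card G - E.card := by
    rw [Finset.card_sdiff_of_subset (Finset.subset_univ E), Finset.card_univ,
      Nat.cast_sub (Finset.card_le_univ E)]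
  have h4 : (E.card : ℝ) ≤ Fintype.card G := by exact_mod_cast Finset.card_le_univ E
  have h5 : (T.card : ℝ) ≤ Fintype.card H := by exact_mod_cast Finset.card_le_univ T
  rw [Finset.card_product, Fintype.card_prod] at h1
  push_cast at h1
  rw [h3] at h1
  have hE0 : (0 : ℝ) ≤ E.card := Nat.cast_nonneg _
  have hT := energy_nonneg T
  set N : ℝ := (Fintype.card G : ℝ)
  set M : ℝ := (Fintype.card H : ℝ)
  set e : ℝ := (E.card : ℝ)
  set t : ℝ := (T.card : ℝ)
  have ht0 : 0 ≤ t := Nat.cast_nonneg _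
  have h6 : (N - e) ^ 4 * t ^ 4 / (N * M) = ((N - e) ^ 4 / N) * (t ^ 4 / M) := by
    field_simp
  have h7 : N ^ 3 - 4 * e * N ^ 2 ≤ (N - e) ^ 4 / N := by
    rw [le_div_iff₀ hN]
    have : 0 ≤ e ^ 2 * (6 * N ^ 2 - 4 * N * e + e ^ 2) := by
      refine mul_nonneg (sq_nonneg _) ?_
      nlinarith
    nlinarith
  have h8 : t ^ 4 / M ≤ M ^ 3 := by
    rw [div_le_iff₀ hM]
    calc t ^ 4 ≤ M ^ 4 := by gcongr
      _ = M ^ 3 * M := by ring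
  have h9 : 0 ≤ t ^ 4 / M := by positivity
  have h10 : (∑ x, corr (indic (Finset.univ \ E)) (indic (Finset.univ \ E)) x ^ 2) *
      (energy T + t ^ 4 / M) ≤ N ^ 3 * (energy T + t ^ 4 / M) :=
    mul_le_mul_of_nonneg_right h2 (by positivity)
  have h11 : (N ^ 3 - 4 * e * N ^ 2) * (t ^ 4 / M) ≤ (N - e) ^ 4 / N * (t ^ 4 / M) :=
    mul_le_mul_of_nonneg_right h7 h9
  have h12 : 4 * e * N ^ 2 * (t ^ 4 / M) ≤ 4 * e * N ^ 2 * M ^ 3 :=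
    mul_le_mul_of_nonneg_left h8 (by positivity)
  rw [mul_pow, h6] at h1
  nlinarith

end Selection

section TreeOrder

/-- The vertices of a tree can be numbered such that every edge joins a vertex to its parent, and
parents have smaller numbers. -/
theorem exists_parent_order {n : ℕ} {T : SimpleGraph (Fin (n + 1))} (hT : T.IsTree) :
    ∃ (rank : Fin (n + 1) → ℕ) (par : ℕ → ℕ), Function.Injective rank ∧ (∀ v, rank v ≤ n) ∧
      (∀ v, v ≠ 0 → par v < v) ∧
      ∀ s ∈ T.edgeSet, ∃ u v, s = s(u, v) ∧ rank u ≠ 0 ∧ par (rank u) = rank v := by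
  classical
  have h1 : ∀ v : Fin (n + 1), ∃ w, v ≠ 0 → T.Adj v w ∧ T.dist w 0 < T.dist v 0 := by
    intro v
    by_cases hv : v = 0
    · exact ⟨0, fun h => absurd hv h⟩
    obtain ⟨q, hq⟩ := hT.1.exists_walk_length_eq_dist v 0
    cases q with
    | nil => exact absurd rfl hv
    | @cons _ w _ h q' =>
      refine ⟨w, fun _ => ⟨h, ?_⟩⟩
      have := SimpleGraph.dist_le q'
      rw [SimpleGraph.Walk.length_cons] at hq
      omega
  choose p hp using h1
  set d : Fin (n + 1) → ℕ := fun v => T.dist v 0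
  set σ : Equiv.Perm (Fin (n + 1)) := Tuple.sort d
  have hmono : Monotone (d ∘ σ) := Tuple.monotone_sort d
  have hlt : ∀ v w, d w < d v → σ.symm w < σ.symm v := by
    intro v w h
    by_contra! h'
    have := hmono h'
    simp only [Function.comp_apply, Equiv.apply_symm_apply] at this
    omega
  have hσ0 : σ.symm 0 = 0 := by
    by_contra h
    have h0 : d (σ 0) ≤ d 0 := by
      have := hmono (Fin.zero_le (σ.symm 0))
      simpa using this
    have h2 : d 0 = 0 := SimpleGraph.dist_self
    have h3 : σ 0 = 0 := by
      by_contra h4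
      have := (hp _ h4).2
      change d _ < d _ at this
      omega
    exact h (by rw [Equiv.symm_apply_eq]; exact h3.symm)
  let par : ℕ → ℕ := fun r =>
    if h : r < n + 1 then (if r = 0 then 0 else (σ.symm (p (σ ⟨r, h⟩)) : ℕ)) else 0
  have hpar : ∀ v, v ≠ 0 → par (σ.symm v : ℕ) = σ.symm (p v) := by
    intro v hv
    have h2 : ((σ.symm v : Fin (n + 1)) : ℕ) ≠ 0 := by
      intro h3
      have h4 : σ.symm v = 0 := Fin.ext h3
      rw [← hσ0] at h4
      exact hv (σ.symm.injective h4)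
    simp only [par, (σ.symm v).is_lt, dif_pos, if_neg h2, Fin.eta, Equiv.apply_symm_apply]
  refine ⟨fun v => σ.symm v, par, fun u v h => σ.symm.injective (Fin.ext h),
    fun v => Nat.lt_succ_iff.1 (σ.symm v).is_lt, ?_, ?_⟩
  · intro r hr
    by_cases h : r < n + 1
    · have h2 : σ ⟨r, h⟩ ≠ 0 := by
        intro h3
        rw [← Equiv.eq_symm_apply, hσ0] at h3
        exact hr (congrArg Fin.val h3)
      have h3 := hlt _ _ (hp _ h2).2
      rw [Equiv.symm_apply_apply] at h3
      simp only [par, dif_pos h, if_neg hr]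
      exact h3
    · simp only [par, dif_neg h]
      omega
  · have hinj : ∀ u v, u ≠ 0 → v ≠ 0 → s(u, p u) = s(v, p v) → u = v := by
      intro u v hu hv h
      by_contra huv
      rcases Sym2.eq_iff.1 h with ⟨h3, -⟩ | ⟨h3, h4⟩
      · exact huv h3
      · have h5 := (hp u hu).2
        have h6 := (hp v hv).2
        rw [h4] at h5
        rw [← h3] at h6
        omega
    have himg : (Finset.univ.erase (0 : Fin (n + 1))).image (fun v => s(v, p v)) =
        T.edgeFinset := by
      refine Finset.eq_of_subset_of_card_le ?_ ?_
      · intro s hs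
        obtain ⟨v, hv, rfl⟩ := Finset.mem_image.1 hs
        rw [SimpleGraph.mem_edgeFinset, SimpleGraph.mem_edgeSet]
        exact (hp v (Finset.ne_of_mem_erase hv)).1
      · have h3 := hT.card_edgeFinset
        rw [Finset.card_image_of_injOn, Finset.card_erase_of_mem (Finset.mem_univ _),
          Finset.card_univ]
        · omega
        · intro u hu v hv h
          exact hinj u v (Finset.ne_of_mem_erase hu) (Finset.ne_of_mem_erase hv) h
    intro s hs
    rw [← SimpleGraph.mem_edgeFinset, ← himg] at hs
    obtain ⟨v, hv, rfl⟩ := Finset.mem_image.1 hs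
    have hv0 := Finset.ne_of_mem_erase hv
    refine ⟨v, p v, rfl, ?_, hpar v hv0⟩
    intro h3
    have h4 : σ.symm v = 0 := Fin.ext h3
    rw [← hσ0] at h4
    exact hv0 (σ.symm.injective h4)

end TreeOrder

section Translates

variable {G : Type*} [AddCommGroup G] [Fintype G]

/-- An embedding of a tree with colours distinct up to sign can be translated to give
edge-disjoint copies of the tree. -/
theorem exists_disjoint_translates (hodd : ∀ x : G, x = -x → x = 0) {n N M : ℕ}
    {T : SimpleGraph (Fin (n + 1))} {rank : Fin (n + 1) → ℕ} {par : ℕ → ℕ}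
    (hrank : Function.Injective rank) (hle : ∀ v, rank v ≤ n) (hpar : ∀ v, v ≠ 0 → par v < v)
    (hedge : ∀ s ∈ T.edgeSet, ∃ u v, s = s(u, v) ∧ rank u ≠ 0 ∧ par (rank u) = rank v)
    (hN : N ≤ Fintype.card G) (hM : Fintype.card G ≤ M) (f : ℕ → G)
    (hinj : ∀ u ≤ n, ∀ v ≤ n, u ≠ v → f u ≠ f v)
    (hcol : ∀ u ≤ n, ∀ v ≤ n, u ≠ 0 → v ≠ 0 → u ≠ v →
      f v - f (par v) ≠ f u - f (par u) ∧ f v - f (par v) ≠ -(f u - f (par u))) :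
    ∃ F : Fin N → (Fin (n + 1) → Fin M), (∀ i, Function.Injective (F i)) ∧
      ∀ i j, i ≠ j → Disjoint (Sym2.map (F i) '' T.edgeSet) (Sym2.map (F j) '' T.edgeSet) := by
  obtain ⟨ι⟩ : Nonempty (G ↪ Fin M) :=
    Function.Embedding.nonempty_of_card_le (by rwa [Fintype.card_fin])
  obtain ⟨t⟩ : Nonempty (Fin N ↪ G) :=
    Function.Embedding.nonempty_of_card_le (by rwa [Fintype.card_fin])
  have hf : ∀ u v, f (rank u) = f (rank v) → u = v := by
    intro u v h
    by_contra huv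
    exact hinj _ (hle u) _ (hle v) (fun h' => huv (hrank h')) h
  refine ⟨fun i v => ι (f (rank v) + t i), ?_, ?_⟩
  · intro i u v h
    exact hf u v (add_right_cancel (ι.injective h))
  · intro i j hij
    rw [Set.disjoint_left]
    rintro _ ⟨s, hs, rfl⟩ ⟨s', hs', h⟩
    obtain ⟨u, v, rfl, hu, huv⟩ := hedge s hs
    obtain ⟨u', v', rfl, hu', huv'⟩ := hedge s' hs'
    simp only [Sym2.map_mk] at h
    have hcol' : u = u' := by
      by_contra hne
      have h1 := hcol _ (hle u) _ (hle u') hu hu' fun h' => hne (hrank h')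
      rw [huv, huv'] at h1
      rcases Sym2.eq_iff.1 h with ⟨h2, h3⟩ | ⟨h2, h3⟩
      · have h4 := ι.injective h2
        have h5 := ι.injective h3
        refine h1.1 ?_
        rw [← add_sub_add_right_eq_sub _ _ (t j), h4, h5, add_sub_add_right_eq_sub]
      · have h4 := ι.injective h2
        have h5 := ι.injective h3
        refine h1.2 ?_
        rw [← add_sub_add_right_eq_sub _ _ (t j), h4, h5, add_sub_add_right_eq_sub, neg_sub]
    subst hcol'
    have hv : v = v' := hrank (huv.symm.trans huv')
    subst hv
    rcases Sym2.eq_iff.1 h with ⟨h2, -⟩ | ⟨h2, h3⟩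
    · exact hij (t.injective (add_left_cancel (ι.injective h2))).symm
    · have h4 := ι.injective h2
      have h5 := ι.injective h3
      have h6 : f (rank u) - f (rank v) = -(f (rank u) - f (rank v)) := by
        rw [neg_sub, ← add_sub_add_right_eq_sub (f (rank u)) _ (t j), h4, h5,
          add_sub_add_right_eq_sub]
      have h7 := hf _ _ (sub_eq_zero.1 (hodd _ h6))
      subst h7
      have := hpar _ hu
      omega

end Translates

section Regions

/-- A family of stars with roots `W` can be mapped injectively into `U ×ˢ J` such that the leaves
of different stars have different second coordinates. -/
theorem exists_star_map {Q C : Type*} [DecidableEq Q] [DecidableEq C] (par : ℕ → ℕ)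
    (W X : Finset ℕ) (hX : ∀ r ∈ X, par r ∈ W) (U : Finset Q) (J : Finset C) (hU : 0 < U.card)
    (hJ : X.card / U.card + W.card ≤ J.card) (z : Q × C) :
    ∃ g : ℕ → Q × C, ∀ r ∈ X, (g r).1 ∈ U ∧ (g r).2 ∈ J ∧
      ∀ u ∈ X, u ≠ r → g u ≠ g r ∧ ((g u).2 = (g r).2 → par u = par r) := by
  classical
  let c : ℕ → ℕ := fun w => (X.filter fun r => par r = w).card
  have h1 : ∑ w ∈ W, (c w / U.card + 1) ≤ J.card := by
    have h2 : ∑ w ∈ W, c w = X.card := (Finset.card_eq_sum_card_fiberwise hX).symm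
    have h3 : ∑ w ∈ W, c w / U.card ≤ X.card / U.card := by
      rw [Nat.le_div_iff_mul_le hU, ← h2, Finset.sum_mul]
      exact Finset.sum_le_sum fun w _ => Nat.div_mul_le_self _ _
    rw [Finset.sum_add_distrib, Finset.sum_const, smul_eq_mul, mul_one]
    omega
  obtain ⟨ι⟩ : Nonempty ((Σ w : W, Fin (c w / U.card + 1)) ↪ J) := by
    refine Function.Embedding.nonempty_of_card_le ?_
    rw [Fintype.card_sigma, Fintype.card_coe]
    simp only [Fintype.card_fin]
    rwa [Finset.sum_coe_sort W fun w => c w / U.card + 1]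
  have h4 : ∀ w, Nonempty ((X.filter fun r => par r = w) ↪ U × Fin (c w / U.card + 1)) := by
    intro w
    refine Function.Embedding.nonempty_of_card_le ?_
    rw [Fintype.card_prod, Fintype.card_coe, Fintype.card_coe, Fintype.card_fin]
    exact (Nat.lt_mul_div_succ (c w) hU).le
  let h : ∀ w, (X.filter fun r => par r = w) ↪ U × Fin (c w / U.card + 1) :=
    fun w => (h4 w).some
  let g : ℕ → Q × C := fun r =>
    if hr : r ∈ X then
      let y := h (par r) ⟨r, Finset.mem_filter.2 ⟨hr, rfl⟩⟩
      ((y.1 : Q), (ι ⟨⟨par r, hX r hr⟩, y.2⟩ : J))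
    else z
  have hg : ∀ r (hr : r ∈ X), g r = (((h (par r) ⟨r, Finset.mem_filter.2 ⟨hr, rfl⟩⟩).1 : Q),
      ((ι ⟨⟨par r, hX r hr⟩, (h (par r) ⟨r, Finset.mem_filter.2 ⟨hr, rfl⟩⟩).2⟩ : J) : C)) := by
    intro r hr
    simp only [g, dif_pos hr]
  refine ⟨g, fun r hr => ?_⟩
  have h5 : ∀ u ∈ X, (g u).2 = (g r).2 → par u = par r := by
    intro u hu h6
    rw [hg u hu, hg r hr] at h6
    have h7 := ι.injective (Subtype.ext h6)
    exact congrArg (fun s => (s.1 : ℕ)) h7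
  refine ⟨?_, ?_, fun u hu hur => ⟨fun h6 => ?_, h5 u hu⟩⟩
  · rw [hg r hr]; exact Subtype.coe_prop _
  · rw [hg r hr]; exact Subtype.coe_prop _
  · have h7 := h5 u hu (congrArg Prod.snd h6)
    rw [hg u hu, hg r hr] at h6
    have h8 := ι.injective (Subtype.ext (congrArg Prod.snd h6))
    have h9 := Subtype.ext (congrArg Prod.fst h6)
    have key : ∀ (w w' : ℕ) (hw : par u = w) (hw' : par r = w') (hm : w ∈ W) (hm' : w' ∈ W),
        w = w' → (h w ⟨u, Finset.mem_filter.2 ⟨hu, hw⟩⟩).1 =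
          (h w' ⟨r, Finset.mem_filter.2 ⟨hr, hw'⟩⟩).1 →
        (⟨⟨w, hm⟩, (h w ⟨u, Finset.mem_filter.2 ⟨hu, hw⟩⟩).2⟩ :
          Σ w : W, Fin (c w / U.card + 1)) =
          ⟨⟨w', hm'⟩, (h w' ⟨r, Finset.mem_filter.2 ⟨hr, hw'⟩⟩).2⟩ → u = r := by
      rintro w w' hw hw' hm hm' rfl e1 e2
      simp only [Sigma.mk.injEq, heq_eq_eq, true_and] at e2
      have := (h w).injective (Prod.ext e1 e2)
      exact congrArg Subtype.val this
    exact hur (key _ _ rfl rfl (hX u hu) (hX r hr) h7 h9 h8)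

variable {Q C : Type*} [AddCommGroup Q] [Fintype Q] [DecidableEq Q]
  [AddCommGroup C] [Fintype C] [DecidableEq C]

/-- The region of a point: `0` for hubs, `1` for star leaves, `2` for links, `3` for the rest. -/
def posRegion (J R : Finset C) (y : Q × C) : ℕ :=
  if y.2 = 0 then 0 else if y.2 ∈ J then 1 else if y.2 ∈ R then 2 else 3

/-- The region of a colour, compatible with `posRegion`; the colours of region `4` are not used. -/
def colRegion (E : Finset Q) (J R : Finset C) (c : Q × C) : ℕ :=
  if c.1 ∈ E then 0 else if c.2 = 0 then 4 else if c.2 ∈ J ∨ -c.2 ∈ J then 1 else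
    if c.2 ∈ R ∨ -c.2 ∈ R then 2 else 3

/-- The second coordinates of the colours reserved for inner edges. -/
def freeColours (J : Finset C) : Finset C := Finset.univ.filter fun x => x ≠ 0 ∧ x ∉ J ∧ -x ∉ J

/-- The second coordinates of the points reserved for inner vertices. -/
def freePoints (J : Finset C) : Finset C := Finset.univ.filter fun x => x ≠ 0 ∧ x ∉ J

theorem card_freeColours_ge (J : Finset C) :
    Fintype.card C ≤ (freeColours J).card + 2 * J.card + 1 := by
  have h1 : (Finset.univ : Finset C) ⊆ freeColours J ∪ (J ∪ J.image Neg.neg) ∪ {0} := by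
    intro x _
    simp only [freeColours, Finset.mem_union, Finset.mem_filter, Finset.mem_univ, true_and,
      Finset.mem_image, Finset.mem_singleton]
    by_cases h0 : x = 0
    · exact Or.inr h0
    by_cases h1 : x ∈ J
    · exact Or.inl (Or.inr (Or.inl h1))
    by_cases h2 : -x ∈ J
    · exact Or.inl (Or.inr (Or.inr ⟨-x, h2, neg_neg x⟩))
    exact Or.inl (Or.inl ⟨h0, h1, h2⟩)
  have h2 := Finset.card_le_card h1
  have h3 := Finset.card_union_le (freeColours J ∪ (J ∪ J.image Neg.neg)) {0}
  have h4 := Finset.card_union_le (freeColours J) (J ∪ J.image Neg.neg)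
  have h5 := Finset.card_union_le J (J.image Neg.neg)
  have h6 : (J.image Neg.neg).card ≤ J.card := Finset.card_image_le
  rw [Finset.card_univ] at h2
  rw [Finset.card_singleton] at h3
  omega

theorem card_freePoints_ge (J : Finset C) :
    Fintype.card C ≤ (freePoints J).card + J.card + 1 := by
  have h1 : (Finset.univ : Finset C) ⊆ freePoints J ∪ J ∪ {0} := by
    intro x _
    simp only [freePoints, Finset.mem_union, Finset.mem_filter, Finset.mem_univ, true_and,
      Finset.mem_singleton]
    tauto
  have h2 := Finset.card_le_card h1
  have h3 := Finset.card_union_le (freePoints J ∪ J) {0}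
  have h4 := Finset.card_union_le (freePoints J) J
  rw [Finset.card_univ] at h2
  rw [Finset.card_singleton] at h3
  omega

theorem pot_product_le (E : Finset Q) (J : Finset C) :
    pot ((Finset.univ \ E) ×ˢ freeColours J) ((Finset.univ : Finset Q) ×ˢ freePoints J) ≤
      (Fintype.card Q : ℝ) ^ 3 * pot (freeColours J) (freePoints J) +
        4 * E.card * (Fintype.card Q : ℝ) ^ 2 * (Fintype.card C : ℝ) ^ 3 := by
  have h1 := energy_product_le E (freeColours J)
  have h2 := energy_product_le (∅ : Finset Q) (freePoints J)
  rw [Finset.sdiff_empty, Finset.card_empty] at h2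
  simp only [CharP.cast_eq_zero, mul_zero, zero_mul, add_zero] at h2
  unfold pot
  linarith

theorem exists_rainbow_of_regions (hC : ∀ x : C, x = -x → x = 0)
    (E : Finset Q) (hE : ∀ x ∈ E, -x ∈ E) (J R : Finset C) (hJR : Disjoint J R)
    (h0 : 0 ∉ J ∪ R) (hneg : ∀ x ∈ J ∪ R, -x ∉ J ∪ R)
    {n : ℕ} {par : ℕ → ℕ} {W : Finset ℕ} {m δ K Φ β a b : ℝ}
    (par_lt : ∀ v, v ≠ 0 → par v < v) (zero_mem : 0 ∈ W) (W_sub : W ⊆ Finset.range (n + 1))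
    (piece_le : ∀ r, ((piece n par W r).card : ℝ) ≤ m) (n_le : n ≤ Fintype.card (Q × C))
    (δ_pos : 0 < δ) (K_pos : 0 < K) (a_nonneg : 0 ≤ a) (b_nonneg : 0 ≤ b)
    (A_large : a + 2 * (innerPart par W (Finset.range (n + 1))).card ≤
      ((Finset.univ \ E).card : ℝ) * (freeColours (J ∪ R)).card)
    (B_large : b + (innerPart par W (Finset.range (n + 1))).card ≤
      (Fintype.card Q : ℝ) * (freePoints (J ∪ R)).card)
    (ab_large : 4 * δ * (Fintype.card (Q × C) : ℝ) ^ 2 ≤ a * b)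
    (pot_small : Real.exp (K / δ + 13 / δ ^ 2 + 3 / δ ^ 3) *
      (((Fintype.card Q : ℝ) ^ 3 * pot (freeColours (J ∪ R)) (freePoints (J ∪ R)) +
        4 * E.card * (Fintype.card Q : ℝ) ^ 2 * (Fintype.card C : ℝ) ^ 3) +
      (36 / δ + 220) * m * (Fintype.card (Q × C) : ℝ) * Fintype.card (Q × C)) ≤ Φ)
    (Φ_le : Φ ≤ (Fintype.card (Q × C) : ℝ) ^ 3)
    (m_small : 3 * m + Φ / (4 * δ ^ 2 * (Fintype.card (Q × C) : ℝ) ^ 2) ≤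
      δ * Fintype.card (Q × C))
    (β_large : Φ / (4 * δ ^ 2 * (Fintype.card (Q × C) : ℝ) ^ 2) +
      13 * Fintype.card (Q × C) / K ≤ β)
    (hub_large : 3 * W.card < E.card)
    (link_large : 3 * (W.card + β) + β < ((Finset.univ \ E).card : ℝ) * R.card)
    (E_small : 0 < (Finset.univ \ E).card)
    (star_large : ((Finset.range (n + 1)).filter fun r => r ∉ W ∧ par r ∈ W).card /
      (Finset.univ \ E).card + W.card ≤ J.card) :
    ∃ f : ℕ → Q × C, (∀ u ≤ n, ∀ v ≤ n, u ≠ v → f u ≠ f v) ∧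
      ∀ u ≤ n, ∀ v ≤ n, u ≠ 0 → v ≠ 0 → u ≠ v →
        f v - f (par v) ≠ f u - f (par u) ∧ f v - f (par v) ≠ -(f u - f (par u)) := by
  have hE' : ∀ x, -x ∈ E ↔ x ∈ E := fun x => ⟨fun h => neg_neg x ▸ hE _ h, hE x⟩
  have hJ0 : ∀ x ∈ J, x ≠ 0 := fun x hx h => h0 (h ▸ Finset.mem_union_left _ hx)
  have hR0 : ∀ x ∈ R, x ≠ 0 := fun x hx h => h0 (h ▸ Finset.mem_union_right _ hx)
  have hJn : ∀ x ∈ J, -x ∉ J := fun x hx h =>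
    hneg x (Finset.mem_union_left _ hx) (Finset.mem_union_left _ h)
  have hRJ : ∀ x ∈ R, x ∉ J ∧ -x ∉ J := fun x hx =>
    ⟨fun h => Finset.disjoint_left.1 hJR h hx, fun h =>
      hneg x (Finset.mem_union_right _ hx) (Finset.mem_union_left _ h)⟩
  have hpos0 : ∀ y : Q × C, posRegion J R y = 0 → y.2 = 0 := by
    intro y hy
    unfold posRegion at hy
    by_contra h
    rw [if_neg h] at hy
    split_ifs at hy
  refine Plan.exists_embedding
    { n := n, par := par, W := W, posreg := posRegion J R, colreg := colRegion E J R
      A₀ := (Finset.univ \ E) ×ˢ freeColours (J ∪ R), B₀ := Finset.univ ×ˢ freePoints (J ∪ R)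
      m := m, δ := δ, K := K, Φ := Φ, β := β, a := a, b := b
      par_lt := par_lt, zero_mem := zero_mem, W_sub := W_sub, piece_le := piece_le
      n_le := n_le, A_neg := ?_, A_ne := ?_, A_reg := ?_, B_reg := ?_, colreg_neg := ?_
      δ_pos := δ_pos, K_pos := K_pos, a_nonneg := a_nonneg, b_nonneg := b_nonneg
      A_large := ?_, B_large := ?_, ab_large := ab_large, pot_small := ?_, Φ_le := Φ_le
      m_small := m_small, β_large := β_large
      exists_hub := ?_, exists_link := ?_, exists_star := ?_ }
  · rintro ⟨x, y⟩ h
    simp only [freeColours, Finset.mem_product, Finset.mem_sdiff, Finset.mem_univ, true_and,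
      Finset.mem_filter, Prod.neg_mk, hE', neg_ne_zero, neg_neg] at h ⊢
    tauto
  · rintro ⟨x, y⟩ h h'
    simp only [freeColours, Finset.mem_product, Finset.mem_filter] at h
    exact h.2.2.1 (hC y (congrArg Prod.snd h'))
  · rintro ⟨x, y⟩ h
    simp only [freeColours, Finset.mem_product, Finset.mem_sdiff, Finset.mem_univ, true_and,
      Finset.mem_filter, Finset.mem_union, not_or] at h
    simp [colRegion, h]
  · rintro ⟨x, y⟩ h
    simp only [freePoints, Finset.mem_product, Finset.mem_univ, true_and,
      Finset.mem_filter, Finset.mem_union, not_or] at h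
    simp [posRegion, h]
  · rintro ⟨x, y⟩
    simp only [colRegion, Prod.neg_mk, hE', neg_eq_zero, neg_neg]
    simp only [or_comm]
  · rw [Finset.card_product]
    exact_mod_cast A_large
  · rw [Finset.card_product, Finset.card_univ]
    exact_mod_cast B_large
  · refine le_trans ?_ pot_small
    gcongr
    exact pot_product_le E (J ∪ R)
  · rintro ⟨x, y⟩
    refine hub_large.trans_le ?_
    refine Finset.card_le_card_of_injOn (fun e => (e + x, 0)) ?_ ?_
    · intro e he
      simp only [Finset.coe_filter, Finset.mem_univ, true_and, Set.mem_ofPred_eq]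
      refine ⟨by simp [posRegion], ?_⟩
      have : ((e + x, (0 : C)) - (x, y)).1 ∈ E := by simpa using he
      simp only [colRegion, if_pos this]
    · intro e _ e' _ h
      simpa using h
  · rintro ⟨x, y⟩ hx
    have hy : y = 0 := hpos0 _ hx
    subst hy
    refine link_large.trans_le ?_
    rw [← Nat.cast_mul, ← Finset.card_product, Nat.cast_le]
    refine Finset.card_le_card_of_injOn (fun e => (e.1 + x, e.2)) ?_ ?_
    · rintro ⟨e, c⟩ he
      simp only [Finset.coe_product, Set.mem_prod, Finset.mem_coe, Finset.mem_sdiff,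
        Finset.mem_univ, true_and] at he
      simp only [Finset.coe_filter, Finset.mem_univ, true_and, Set.mem_ofPred_eq]
      have h1 := hRJ c he.2
      have h2 := hR0 c he.2
      simp [posRegion, colRegion, h1, h2, he.1, he.2]
    · rintro ⟨e, c⟩ _ ⟨e', c'⟩ _ h
      simpa using h
  · intro x hx hxinj
    obtain ⟨g, hg⟩ := exists_star_map par W
      ((Finset.range (n + 1)).filter fun r => r ∉ W ∧ par r ∈ W)
      (fun r hr => (Finset.mem_filter.1 hr).2.2) (Finset.univ \ E) J E_small star_large 0
    refine ⟨fun r => x (par r) + g r, fun r hr hrW hpr => ?_⟩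
    obtain ⟨h1, h2, h3⟩ := hg r (Finset.mem_filter.2 ⟨hr, hrW, hpr⟩)
    have h4 : (x (par r)).2 = 0 := hpos0 _ (hx _ hpr)
    rw [Finset.mem_sdiff] at h1
    refine ⟨?_, ?_, ?_⟩
    · simp [posRegion, h4, h2, hJ0 _ h2]
    · simp [colRegion, h1.2, h2, hJ0 _ h2]
    · intro u hu huW hpu hur
      obtain ⟨h5, h6⟩ := h3 u (Finset.mem_filter.2 ⟨hu, huW, hpu⟩) hur
      have h7 : (x (par u)).2 = 0 := hpos0 _ (hx _ hpu)
      obtain ⟨-, h8, -⟩ := hg u (Finset.mem_filter.2 ⟨hu, huW, hpu⟩)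
      simp only [add_sub_cancel_left]
      refine ⟨fun h => ?_, fun h => h5 h.symm, fun h => ?_⟩
      · have h9 := h6 (by simpa [h4, h7] using congrArg Prod.snd h)
        rw [h9] at h
        exact h5 (add_left_cancel h)
      · have h9 : (g r).2 = -(g u).2 := congrArg Prod.snd h
        exact hJn _ h8 (h9 ▸ h2)

end Regions

section Assembly

theorem card_roots_add_card_inner {n : ℕ} {par : ℕ → ℕ} {W : Finset ℕ}
    (hW : W ⊆ Finset.range (n + 1)) :
    ((Finset.range (n + 1)).filter fun r => r ∉ W ∧ par r ∈ W).card +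
      (innerPart par W (Finset.range (n + 1))).card + W.card = n + 1 := by
  have h1 : (Finset.range (n + 1)).filter (fun r => r ∉ W ∧ par r ∈ W) =
      ((Finset.range (n + 1)) \ W).filter fun r => par r ∈ W := by
    ext; simp [and_assoc]
  have h2 : innerPart par W (Finset.range (n + 1)) =
      ((Finset.range (n + 1)) \ W).filter fun r => ¬ par r ∈ W := by
    ext; simp [innerPart, and_assoc]
  have h3 := Finset.card_sdiff_add_card_eq_card hW
  rw [Finset.card_range] at h3
  rw [h1, h2, Finset.card_filter_add_card_filter_not, h3]

theorem exists_symmetric_subset {Q : Type*} [AddCommGroup Q] [Fintype Q] [DecidableEq Q] (t : ℕ)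
    (ht : t ≤ Fintype.card Q) :
    ∃ E : Finset Q, (∀ x ∈ E, -x ∈ E) ∧ t ≤ E.card ∧ E.card ≤ 2 * t := by
  obtain ⟨F, -, hF⟩ := Finset.exists_subset_card_eq (s := (Finset.univ : Finset Q)) (n := t)
    (by rwa [Finset.card_univ])
  refine ⟨F ∪ F.image Neg.neg, ?_, ?_, ?_⟩
  · intro x hx
    rcases Finset.mem_union.1 hx with h | h
    · exact Finset.mem_union_right _ (Finset.mem_image_of_mem _ h)
    · obtain ⟨y, hy, rfl⟩ := Finset.mem_image.1 h
      rw [neg_neg]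
      exact Finset.mem_union_left _ hy
  · rw [← hF]
    exact Finset.card_le_card Finset.subset_union_left
  · have h1 := Finset.card_union_le F (F.image Neg.neg)
    have h2 : (F.image Neg.neg).card ≤ F.card := Finset.card_image_le
    omega

/-- A cut into few pieces of relatively small size. -/
theorem exists_cut_of_pos {n : ℕ} {par : ℕ → ℕ} (hpar : ∀ v, v ≠ 0 → par v < v) {μ N : ℝ}
    (hμ : 0 < μ) (hN : 2 ≤ μ * N) (hn : n + 1 ≤ N) :
    ∃ W ⊆ Finset.range (n + 1), 0 ∈ W ∧ (W.card : ℝ) ≤ 2 / μ + 1 ∧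
      ∀ r, ((piece n par W r).card : ℝ) ≤ μ * N := by
  have h1 : (1 : ℕ) ≤ ⌊μ * N⌋₊ := by
    rw [Nat.one_le_floor_iff]
    linarith
  obtain ⟨W, hW, h0, hc, hp⟩ := exists_cut n hpar (m := ⌊μ * N⌋₊) h1
  have h2 : (⌊μ * N⌋₊ : ℝ) ≤ μ * N := Nat.floor_le (by linarith)
  have h3 : μ * N < ⌊μ * N⌋₊ + 1 := Nat.lt_floor_add_one _
  refine ⟨W, hW, h0, ?_, fun r => ?_⟩
  · have h4 : (W.card : ℝ) * ⌊μ * N⌋₊ ≤ n + 1 + ⌊μ * N⌋₊ := by exact_mod_cast hc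
    set y : ℝ := (⌊μ * N⌋₊ : ℝ)
    have h5 : 1 ≤ y := Nat.one_le_cast.2 h1
    have h6 : N ≤ 2 / μ * y := by
      rw [div_mul_eq_mul_div, le_div_iff₀ hμ]
      linarith
    by_contra! h7
    have h8 : (2 / μ + 1) * y < W.card * y := by gcongr
    nlinarith
  · refine le_trans ?_ h2
    exact_mod_cast hp r

variable {Q C : Type*} [AddCommGroup Q] [Fintype Q] [DecidableEq Q]
  [AddCommGroup C] [Fintype C] [DecidableEq C]

set_option maxHeartbeats 1000000 in
theorem exists_rainbow_of_large (hC : ∀ x : C, x = -x → x = 0) {ε δ κ X μ : ℝ} {n t : ℕ}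
    (hε : 0 < ε) (hε1 : ε ≤ 1) (hδ : δ = ε / 128) (hκ : κ = δ ^ 3 / 8)
    (hX : X = Real.exp ((416 / (ε / 24)) / δ + 13 / δ ^ 2 + 3 / δ ^ 3))
    (hμ : μ = κ / (2 * X * (36 / δ + 220))) (ht : 3 * (2 / μ + 1) < t)
    (hQt : 48 * t ≤ ε * Fintype.card Q) (hQX : 32 * X * t ≤ κ * Fintype.card Q)
    (hQ24 : 24 ≤ Fintype.card Q)
    (hk1 : 12 * (3 + 2 * (2 / μ + 1)) ≤ ε * Fintype.card C)
    (hk2 : 1232 * X * Real.exp (4 / (ε / 8)) ≤ κ * Fintype.card C)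
    (hk3 : 2 ≤ μ * Fintype.card C)
    (hn : (2 + ε) * n ≤ (Fintype.card Q : ℝ) * Fintype.card C)
    {par : ℕ → ℕ} (hpar : ∀ v, v ≠ 0 → par v < v) :
    ∃ f : ℕ → Q × C, (∀ u ≤ n, ∀ v ≤ n, u ≠ v → f u ≠ f v) ∧
      ∀ u ≤ n, ∀ v ≤ n, u ≠ 0 → v ≠ 0 → u ≠ v →
        f v - f (par v) ≠ f u - f (par u) ∧ f v - f (par v) ≠ -(f u - f (par u)) := by
  have hs := card_pos_real (G := Q)
  have hk := card_pos_real (G := C)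
  have hk1' : (1 : ℝ) ≤ Fintype.card C := by exact_mod_cast Fintype.card_pos
  have hQ24' : (24 : ℝ) ≤ Fintype.card Q := by exact_mod_cast hQ24
  have hδ0 : 0 < δ := by rw [hδ]; positivity
  have hδ1 : δ ≤ 1 / 128 := by rw [hδ]; linarith
  have hκ0 : 0 < κ := by rw [hκ]; positivity
  have hX0 : 0 < X := hX ▸ Real.exp_pos _
  have hX1 : 1 ≤ X := by rw [hX]; exact Real.one_le_exp (by positivity)
  have hμ0 : 0 < μ := by rw [hμ]; positivity
  have hκδ : κ ≤ δ := by
    rw [hκ]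
    have : δ ^ 3 ≤ δ := pow_le_of_le_one hδ0.le (by linarith) (by norm_num)
    linarith
  have hμδ : μ ≤ δ / 6 := by
    rw [hμ, div_le_iff₀ (by positivity)]
    have h1 : (6 : ℝ) ≤ 2 * X * (36 / δ + 220) := by
      have : 0 < 36 / δ := by positivity
      nlinarith only [this, hX1]
    have h2 : δ / 6 * 6 ≤ δ / 6 * (2 * X * (36 / δ + 220)) := by gcongr
    linarith
  have hcard : (Fintype.card (Q × C) : ℝ) = Fintype.card Q * Fintype.card C := by
    rw [Fintype.card_prod]; push_cast; ring
  set s : ℝ := (Fintype.card Q : ℝ)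
  set k : ℝ := (Fintype.card C : ℝ)
  set w₀ : ℝ := 2 / μ + 1
  have hw₀ : 1 ≤ w₀ := by
    have : 0 < 2 / μ := by positivity
    simp only [w₀]; linarith
  have hN0 : 0 < s * k := by positivity
  have hNk : 24 * k ≤ s * k := by gcongr
  have h2n : 2 * (n : ℝ) ≤ (1 - ε / 3) * (s * k) := by
    have hn0 : (0 : ℝ) ≤ n := Nat.cast_nonneg _
    have h1 : (1 - ε / 3) * ((2 + ε) * n) ≤ (1 - ε / 3) * (s * k) :=
      mul_le_mul_of_nonneg_left hn (by linarith)
    have h2 : 0 ≤ (ε / 3 - ε ^ 2 / 3) * n := by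
      refine mul_nonneg ?_ hn0
      nlinarith only [hε, hε1]
    linarith only [h1, h2]
  have hsw : s * (3 + 2 * w₀) ≤ ε / 12 * (s * k) := by
    have h1 : s * (12 * (3 + 2 * w₀)) ≤ s * (ε * k) := by gcongr
    linarith
  have hεN : ε * (s * k) ≤ s * k := mul_le_of_le_one_left hN0.le hε1
  have hεN0 : 0 < ε * (s * k) := by positivity
  have hμN : 2 ≤ μ * (s * k) := by
    have h1 : 1 * (μ * k) ≤ s * (μ * k) := by
      gcongr
      linarith
    linarith
  obtain ⟨W, hW, h0W, hWc, hp⟩ := exists_cut_of_pos hpar (n := n) (N := s * k) hμ0 hμN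
    (by linarith)
  have hεs : ε * s ≤ s := mul_le_of_le_one_left hs.le hε1
  obtain ⟨E, hE, htE, hEt⟩ := exists_symmetric_subset (Q := Q) t (by
    have : (t : ℝ) ≤ s := by linarith
    exact Nat.cast_le.1 this)
  have hparts := card_roots_add_card_inner (par := par) hW
  set P : ℕ := ((Finset.range (n + 1)).filter fun r => r ∉ W ∧ par r ∈ W).card with hP
  set g : ℕ := (innerPart par W (Finset.range (n + 1))).card with hg
  have hW1 : 1 ≤ W.card := Finset.card_pos.2 ⟨0, h0W⟩
  have hgP : (P : ℝ) + g ≤ n := by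
    have : P + g ≤ n := by omega
    exact_mod_cast this
  have hWc' : (W.card : ℝ) ≤ w₀ := hWc
  have hg0 : (0 : ℝ) ≤ g := Nat.cast_nonneg _
  have hP0 : (0 : ℝ) ≤ P := Nat.cast_nonneg _
  have htE' : (t : ℝ) ≤ E.card := by exact_mod_cast htE
  have hEt' : (E.card : ℝ) ≤ 2 * t := by exact_mod_cast hEt
  have hq : (((Finset.univ \ E : Finset Q)).card : ℝ) = s - E.card := by
    rw [Finset.card_sdiff_of_subset (Finset.subset_univ E), Finset.card_univ,
      Nat.cast_sub (Finset.card_le_univ E)]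
  have hEs : (E.card : ℝ) ≤ ε / 24 * s := by linarith
  have hE0 : (0 : ℝ) ≤ E.card := Nat.cast_nonneg _
  set q : ℕ := (Finset.univ \ E : Finset Q).card
  have hq1 : 23 / 24 * s ≤ q := by rw [hq]; linarith
  have hqs : (q : ℝ) ≤ s := by rw [hq]; linarith
  have hqpos : 0 < q := by
    have : (0 : ℝ) < q := by linarith
    exact_mod_cast this
  have hEk : E.card * k ≤ ε / 24 * (s * k) := by
    rw [← mul_assoc]; gcongr
  obtain ⟨l, hl1, hl2⟩ : ∃ l : ℕ, ε / 24 * k ≤ l ∧ (l : ℝ) ≤ ε / 24 * k + 1 :=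
    ⟨_, Nat.le_ceil _, (Nat.ceil_lt_add_one (by positivity)).le⟩
  obtain ⟨j, hj⟩ : ∃ j, j = P / q + W.card := ⟨_, rfl⟩
  have hqj : (q : ℝ) * j ≤ P + q * w₀ := by
    have h1 : (q : ℝ) * (P / q : ℕ) ≤ P := by exact_mod_cast Nat.mul_div_le P q
    have h2 : (q : ℝ) * W.card ≤ q * w₀ := by gcongr
    rw [hj]
    push_cast at h1 ⊢
    linarith
  have hql : (q : ℝ) * l ≤ ε / 24 * (s * k) + s := by
    have h1 : (q : ℝ) * l ≤ s * (ε / 24 * k + 1) := by gcongr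
    linarith
  have hqw : (q : ℝ) * w₀ ≤ s * w₀ := by gcongr
  have hqk : (q : ℝ) * k = s * k - E.card * k := by rw [hq]; ring
  have hA : ε / 8 * (s * k) + 2 * g ≤ q * (k - 1 - 2 * (j + l)) := by
    linarith only [hqj, hql, hqw, hqk, hqs, hEk, hgP, h2n, hsw, hs]
  have hjl : ε / 8 * k + 2 * ((j + l : ℕ) : ℝ) + 1 ≤ k := by
    have hq0 : (0 : ℝ) < q := by exact_mod_cast hqpos
    have h1 : q * (ε / 8 * k) ≤ q * (k - 1 - 2 * (j + l)) := by
      refine le_trans ?_ hA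
      have : q * (ε / 8 * k) ≤ s * (ε / 8 * k) := by gcongr
      linarith
    have h2 := le_of_mul_le_mul_left h1 hq0
    push_cast
    linarith
  obtain ⟨J', hJ'c, hJ'0, hJ'n, hJ'p⟩ := exists_small_pot hC (α := ε / 8) (by positivity)
    (j + l) hjl
  obtain ⟨J, hJJ', hJc⟩ := Finset.exists_subset_card_eq (s := J') (n := j) (by omega)
  have hunion : J ∪ J' \ J = J' := Finset.union_sdiff_of_subset hJJ'
  have hRc : (J' \ J).card = l := by
    rw [Finset.card_sdiff_of_subset hJJ']; omega
  have hfc : k ≤ ((freeColours J').card : ℝ) + 2 * (j + l : ℕ) + 1 := by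
    have := (Nat.cast_le (α := ℝ)).2 (card_freeColours_ge J')
    rw [hJ'c] at this
    exact this.trans_eq (by push_cast; ring)
  have hfp : k ≤ ((freePoints J').card : ℝ) + (j + l : ℕ) + 1 := by
    have := (Nat.cast_le (α := ℝ)).2 (card_freePoints_ge J')
    rw [hJ'c] at this
    exact this.trans_eq (by push_cast; ring)
  push_cast at hfc hfp
  have hεk : 0 < ε * k := by positivity
  have hjlk : ((j + l : ℕ) : ℝ) ≤ k := by
    have : (0 : ℝ) ≤ ((j + l : ℕ) : ℝ) := Nat.cast_nonneg _
    linarith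
  have hpot : pot (freeColours J') (freePoints J') ≤ Real.exp (4 / (ε / 8)) * (308 * k ^ 2) := by
    refine hJ'p.trans ?_
    have h1 : 4 / (ε / 8) * ((j + l : ℕ) : ℝ) / k ≤ 4 / (ε / 8) := by
      rw [mul_div_assoc]
      refine mul_le_of_le_one_right (by positivity) ?_
      rwa [div_le_one hk]
    have h2 : 88 * k + 220 * k * ((j + l : ℕ) : ℝ) ≤ 308 * k ^ 2 := by
      have : 220 * k * ((j + l : ℕ) : ℝ) ≤ 220 * k * k := by gcongr
      nlinarith only [this, hk1']
    change Real.exp (4 / (ε / 8) * ((j + l : ℕ) : ℝ) / k) *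
      (88 * k + 220 * k * ((j + l : ℕ) : ℝ)) ≤ _
    gcongr
  have hΦ : κ * (s * k) ^ 3 / (4 * δ ^ 2 * (s * k) ^ 2) = δ / 32 * (s * k) := by
    rw [hκ]; field_simp; norm_num
  refine exists_rainbow_of_regions hC E hE J (J' \ J) Finset.disjoint_sdiff
    (m := μ * (s * k)) (δ := δ) (K := 416 / (ε / 24)) (Φ := κ * (s * k) ^ 3)
    (β := δ / 32 * (s * k) + ε / 24 / 32 * (s * k)) (a := ε / 8 * (s * k)) (b := s * k / 4)
    (hunion.symm ▸ hJ'0) (hunion.symm ▸ hJ'n) hpar h0W hW hp ?_ hδ0 (by positivity)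
    (by positivity) (by positivity) ?_ ?_ ?_ ?_ ?_ ?_ ?_ ?_ ?_ hqpos ?_
  · have h1 : (n : ℝ) ≤ Fintype.card (Q × C) := by
      rw [hcard]; linarith
    exact_mod_cast h1
  · rw [hunion]
    refine hA.trans ?_
    gcongr
    linarith
  · rw [hunion]
    have h1 : s * (k - 1 - (j + l)) ≤ s * (freePoints J').card := by
      gcongr
      linarith
    have h2 : s * j = q * j + E.card * j := by rw [hq]; ring
    have h3 : E.card * (j : ℝ) ≤ E.card * k := by
      gcongr
      have : (0 : ℝ) ≤ l := Nat.cast_nonneg _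
      push_cast at hjlk
      linarith only [this, hjlk]
    have h4 : s * l ≤ ε / 24 * (s * k) + s := by
      have h1 : s * l ≤ s * (ε / 24 * k + 1) := by gcongr
      linarith
    have h5 : s * 1 ≤ s * w₀ := by gcongr
    change s * k / 4 + g ≤ s * (freePoints J').card
    linarith only [h1, h2, h3, h4, h5, hqj, hqw, hEk, hgP, h2n, hsw, hεN, hs]
  · rw [hcard, hδ]
    apply le_of_eq
    ring
  · rw [hunion, hcard, ← hX]
    have h1 : X * (s ^ 3 * pot (freeColours J') (freePoints J')) ≤ κ / 4 * (s * k) ^ 3 := by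
      calc X * (s ^ 3 * pot (freeColours J') (freePoints J'))
          ≤ X * (s ^ 3 * (Real.exp (4 / (ε / 8)) * (308 * k ^ 2))) := by gcongr
        _ = (1232 * X * Real.exp (4 / (ε / 8))) * (s ^ 3 * k ^ 2 / 4) := by ring
        _ ≤ κ * k * (s ^ 3 * k ^ 2 / 4) := by gcongr
        _ = κ / 4 * (s * k) ^ 3 := by ring
    have h2 : X * (4 * E.card * s ^ 2 * k ^ 3) ≤ κ / 4 * (s * k) ^ 3 := by
      calc X * (4 * E.card * s ^ 2 * k ^ 3) ≤ X * (4 * (2 * t) * s ^ 2 * k ^ 3) := by gcongr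
        _ = (32 * X * t) * (s ^ 2 * k ^ 3 / 4) := by ring
        _ ≤ κ * s * (s ^ 2 * k ^ 3 / 4) := by gcongr
        _ = κ / 4 * (s * k) ^ 3 := by ring
    have h3 : X * ((36 / δ + 220) * (μ * (s * k)) * (s * k) * (s * k)) =
        κ / 2 * (s * k) ^ 3 := by
      have h4 : X * (36 / δ + 220) * μ = κ / 2 := by
        rw [hμ]; field_simp
      calc _ = X * (36 / δ + 220) * μ * (s * k) ^ 3 := by ring
        _ = _ := by rw [h4]
    change X * (s ^ 3 * pot (freeColours J') (freePoints J') + 4 * E.card * s ^ 2 * k ^ 3 +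
      (36 / δ + 220) * (μ * (s * k)) * (s * k) * (s * k)) ≤ _
    linarith only [h1, h2, h3]
  · rw [hcard]
    refine mul_le_of_le_one_left (by positivity) (by linarith)
  · rw [hcard, hΦ]
    have h1 : μ * (s * k) ≤ δ / 6 * (s * k) := by gcongr
    have h2 : 0 < δ * (s * k) := by positivity
    linarith only [h1, h2]
  · rw [hcard, hΦ]
    apply le_of_eq
    field_simp
    ring
  · have h1 : (3 * W.card : ℝ) < E.card := by linarith
    exact_mod_cast h1
  · rw [hRc]
    have h1 : 23 / 24 * s * (ε / 24 * k) ≤ q * l := by gcongr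
    have h2 : δ * (s * k) ≤ ε / 24 * (s * k) := by
      gcongr
      rw [hδ]; linarith
    have h3 : 24 * (3 * (W.card : ℝ)) ≤ ε / 4 * (s * k) := by
      have h4 : ε / 4 * (24 * k) ≤ ε / 4 * (s * k) := by gcongr
      linarith only [h4, hWc', hk1]
    have h5 : 0 < ε * (s * k) := by positivity
    change 3 * (W.card + (δ / 32 * (s * k) + ε / 24 / 32 * (s * k))) +
      (δ / 32 * (s * k) + ε / 24 / 32 * (s * k)) < (q : ℝ) * l
    linarith only [h1, h2, h3, h5]
  · rw [hJc, hj]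

end Assembly

section Ringel

theorem ZMod.eq_zero_of_eq_neg {N : ℕ} (hN : Odd N) (x : ZMod N) (h : x = -x) : x = 0 := by
  rcases (ZMod.neg_eq_self_iff x).1 h.symm with h | h
  · exact h
  · rw [← h] at hN
    exact absurd hN (by simp)

theorem exists_rainbow {ε : ℝ} (hε : 0 < ε) (hε1 : ε ≤ 1) :
    ∃ S : ℕ, Odd S ∧ ∃ k₀ : ℕ, ∀ k, Odd k → k₀ ≤ k → ∀ n : ℕ, (2 + ε) * n ≤ S * k →
      ∀ par : ℕ → ℕ, (∀ v, v ≠ 0 → par v < v) →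
      ∃ f : ℕ → ZMod S × ZMod k, (∀ u ≤ n, ∀ v ≤ n, u ≠ v → f u ≠ f v) ∧
        ∀ u ≤ n, ∀ v ≤ n, u ≠ 0 → v ≠ 0 → u ≠ v →
          f v - f (par v) ≠ f u - f (par u) ∧ f v - f (par v) ≠ -(f u - f (par u)) := by
  obtain ⟨δ, hδ⟩ : ∃ δ, δ = ε / 128 := ⟨_, rfl⟩
  obtain ⟨κ, hκ⟩ : ∃ κ, κ = δ ^ 3 / 8 := ⟨_, rfl⟩
  obtain ⟨X, hX⟩ : ∃ X, X = Real.exp ((416 / (ε / 24)) / δ + 13 / δ ^ 2 + 3 / δ ^ 3) := ⟨_, rfl⟩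
  obtain ⟨μ, hμ⟩ : ∃ μ, μ = κ / (2 * X * (36 / δ + 220)) := ⟨_, rfl⟩
  obtain ⟨t, ht⟩ := exists_nat_gt (3 * (2 / μ + 1))
  have hδ0 : 0 < δ := by rw [hδ]; positivity
  have hκ0 : 0 < κ := by rw [hκ]; positivity
  have hX0 : 0 < X := hX ▸ Real.exp_pos _
  have hμ0 : 0 < μ := by rw [hμ]; positivity
  obtain ⟨S₁, hS₁⟩ := exists_nat_ge (48 * t / ε)
  obtain ⟨S₂, hS₂⟩ := exists_nat_ge (32 * X * t / κ)
  obtain ⟨k₁, hk₁⟩ := exists_nat_ge (12 * (3 + 2 * (2 / μ + 1)) / ε)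
  obtain ⟨k₂, hk₂⟩ := exists_nat_ge (1232 * X * Real.exp (4 / (ε / 8)) / κ)
  obtain ⟨k₃, hk₃⟩ := exists_nat_ge (2 / μ)
  rw [div_le_iff₀' hε] at hS₁ hk₁
  rw [div_le_iff₀' hκ0] at hS₂ hk₂
  rw [div_le_iff₀' hμ0] at hk₃
  have key : ∀ {c y z : ℝ} {p q : ℕ}, 0 < c → z ≤ c * p → p ≤ q → (q : ℝ) = y → z ≤ c * y := by
    rintro c y z p q hc h1 h2 rfl
    refine h1.trans ?_
    gcongr
  refine ⟨2 * (S₁ + S₂ + 12) + 1, odd_two_mul_add_one _, k₁ + k₂ + k₃,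
    fun k hk hk0 n hn par hpar => ?_⟩
  obtain ⟨S, hS⟩ : ∃ S, S = 2 * (S₁ + S₂ + 12) + 1 := ⟨_, rfl⟩
  rw [← hS] at hn ⊢
  have : NeZero S := ⟨by omega⟩
  have : NeZero k := ⟨hk.pos.ne'⟩
  have hcS : (S : ℝ) = Fintype.card (ZMod S) := by rw [ZMod.card]
  have hck : (k : ℝ) = Fintype.card (ZMod k) := by rw [ZMod.card]
  refine exists_rainbow_of_large (fun x => ZMod.eq_zero_of_eq_neg hk x) hε hε1 hδ hκ hX hμ ht
    (key hε hS₁ (by omega) hcS) (key hκ0 hS₂ (by omega) hcS) ?_ (key hε hk₁ (by omega) hck)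
    (key hκ0 hk₂ (by omega) hck) (key hμ0 hk₃ (by omega) hck) ?_ hpar
  · rw [ZMod.card]; omega
  · rwa [← hcS, ← hck]

end Ringel

/-- asymptotic Ringel: For every `ε > 0` and all sufficiently large `n`,
every tree `T` with `n + 1` vertices packs at least `2n + 1` times into the complete graph
on `⌈(2 + ε) n⌉` vertices: there are `2n + 1` pairwise edge-disjoint copies of `T`. -/
theorem approximate_ringel (ε : ℝ) (hε : 0 < ε) :
    ∃ n₀ : ℕ, ∀ n : ℕ, n₀ ≤ n →
      ∀ T : SimpleGraph (Fin (n + 1)), T.IsTree →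
        ∃ f : Fin (2 * n + 1) → (Fin (n + 1) → Fin ⌈(2 + ε) * (n : ℝ)⌉₊),
          (∀ i, Function.Injective (f i)) ∧
          (∀ i j, i ≠ j →
            Disjoint (Sym2.map (f i) '' T.edgeSet) (Sym2.map (f j) '' T.edgeSet)) := by
  obtain ⟨η, hη0, hη1, hηε⟩ : ∃ η : ℝ, 0 < η ∧ η ≤ 1 ∧ 2 * η ≤ ε :=
    ⟨min 1 (ε / 2), by positivity, min_le_left _ _, by linarith [min_le_right 1 (ε / 2)]⟩
  obtain ⟨S, hS, k₀, hrb⟩ := exists_rainbow hη0 hη1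
  obtain ⟨n₁, hn₁⟩ := exists_nat_ge ((2 * S + 1) / η)
  rw [div_le_iff₀' hη0] at hn₁
  refine ⟨n₁ + S * (k₀ + 3), fun n hn T hT => ?_⟩
  have hS0 : 0 < S := hS.pos
  obtain ⟨M, hM⟩ : ∃ M, M = ⌈(2 + ε) * (n : ℝ)⌉₊ := ⟨_, rfl⟩
  rw [← hM]
  have hM1 : (2 + ε) * n ≤ M := hM ▸ Nat.le_ceil _
  have hnM : n ≤ M := by
    have : (n : ℝ) ≤ M := by
      have : (0 : ℝ) ≤ (1 + ε) * n := by positivity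
      linarith
    exact_mod_cast this
  obtain ⟨k, hk, hkk, hkM, hMk⟩ : ∃ k, Odd k ∧ k₀ ≤ k ∧ S * k ≤ M ∧ M < S * (k + 2) := by
    have h1 : k₀ + 3 ≤ M / S := by
      rw [Nat.le_div_iff_mul_le hS0, mul_comm]
      omega
    refine ⟨2 * ((M / S - 1) / 2) + 1, odd_two_mul_add_one _, by omega, ?_, ?_⟩
    · refine le_trans (Nat.mul_le_mul_left S ?_) (Nat.mul_div_le M S)
      omega
    · refine lt_of_lt_of_le (Nat.lt_mul_div_succ M hS0) (Nat.mul_le_mul_left S ?_)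
      omega
  have hMk' : (M : ℝ) < S * (k + 2) := by exact_mod_cast hMk
  have hn1 : η * n₁ ≤ η * n := by
    have : n₁ ≤ n := by omega
    gcongr
  have hεn : 2 * η * n ≤ ε * n := by gcongr
  have hlarge : (2 + η) * n + 1 ≤ S * k := by nlinarith only [hM1, hMk', hn1, hn₁, hεn]
  obtain ⟨rank, par, hrank, hle, hpar, hedge⟩ := exists_parent_order hT
  obtain ⟨f, hf, hcol⟩ := hrb k hk hkk n (by linarith) par hpar
  have : NeZero S := ⟨hS0.ne'⟩
  have : NeZero k := ⟨hk.pos.ne'⟩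
  have hcard : Fintype.card (ZMod S × ZMod k) = S * k := by
    rw [Fintype.card_prod, ZMod.card, ZMod.card]
  refine exists_disjoint_translates (G := ZMod S × ZMod k) ?_ hrank hle hpar hedge ?_ ?_ f hf hcol
  · rintro ⟨x, y⟩ h
    exact Prod.ext (ZMod.eq_zero_of_eq_neg hS x (congrArg Prod.fst h))
      (ZMod.eq_zero_of_eq_neg hk y (congrArg Prod.snd h))
  · rw [hcard]
    have h1 : (2 * n + 1 : ℝ) ≤ S * k := by
      have : 0 ≤ η * n := by positivity
      linarith
    exact_mod_cast h1
  · rwa [hcard]
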